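/- arXiv:1708.04992 — 6 statements merged into one kernel-verified Lean document; each statement's English description precedes it below -/
import Mathlib

section
/- Suppose P ∈ R satisfies S(P ⊗ P) = 0, equivalently ∑_{a∈ℕ} ((pderiv a P) ⊗ (X_a · P) − (X_a · P) ⊗ (pderiv a P)) = 0 in R ⊗[ℂ] R (the sum is finite since pderiv a P = 0 for all but finitely many a). Then P is a constant polynomial. (Hence, apart from scalar multiples of the vacuum vector, no element of the CKP Fock space F_χ solves the algebraic Hirota equation Res_z (χ(z) ⊗ χ(−z))(τ ⊗ τ) = 0 of the CKP hierarchy.) -/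
open MvPolynomial TensorProduct

namespace MvPolynomial

variable {σ K : Type*}

theorem totalDegree_pderiv_le [CommSemiring K] (i : σ) (p : MvPolynomial σ K) :
    (pderiv i p).totalDegree ≤ p.totalDegree := by
  refine Finset.sup_le fun m hm => ?_
  have hmem : m + Finsupp.single i 1 ∈ p.support := by
    rw [mem_support_iff, coeff_pderiv] at hm
    exact mem_support_iff.2 (left_ne_zero_of_mul hm)
  refine le_trans ?_ (le_totalDegree hmem)
  rw [Finsupp.sum_add_index' (fun _ => rfl) (fun _ _ _ => rfl)]
  exact Nat.le_add_right _ _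

theorem coeff_single_sum_smul_X [CommSemiring K] (s : Finset σ) (c : σ → K) {i : σ} (hi : i ∈ s) :
    coeff (Finsupp.single i 1) (∑ j ∈ s, c j • (X j : MvPolynomial σ K)) = c i := by
  classical
  simp [coeff_sum, coeff_X, Finsupp.single_left_inj, hi]

theorem exists_eq_C_of_forall_pderiv_eq_zero [CommSemiring K] [NoZeroDivisors K] [CharZero K]
    {p : MvPolynomial σ K} (h : ∀ i ∈ p.vars, pderiv i p = 0) : ∃ c, p = C c := by
  suffices hv : p.vars = ∅ from ⟨_, vars_eq_empty_iff_eq_C.1 hv⟩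
  refine Finset.eq_empty_of_forall_notMem fun i hi => ?_
  obtain ⟨m, hm, him⟩ := (mem_vars_iff_mem_support i).1 hi
  have hle : Finsupp.single i 1 ≤ m :=
    Finsupp.single_le_iff.2 (Nat.one_le_iff_ne_zero.2 (Finsupp.mem_support_iff.1 him))
  have hc := coeff_pderiv (i := i) p (m - Finsupp.single i 1)
  rw [h i hi, coeff_zero, tsub_add_cancel_of_le hle] at hc
  exact mul_ne_zero (mem_support_iff.1 hm) (Nat.cast_add_one_ne_zero _) hc.symm

/-- Evaluating the second tensor factor at `y` turns the Hirota equation into an identity of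
polynomials in the first factor. -/
theorem sum_eval_smul_pderiv_eq_mul [CommRing K] (p : MvPolynomial σ K) (s : Finset σ)
    (h : ∑ i ∈ s, ((pderiv i p) ⊗ₜ[K] (X i * p) - (X i * p) ⊗ₜ[K] (pderiv i p)) = 0)
    (y : σ → K) :
    ∑ i ∈ s, eval y (X i * p) • pderiv i p = p * ∑ i ∈ s, eval y (pderiv i p) • X i := by
  have h' := congrArg (TensorProduct.rid K (MvPolynomial σ K) ∘
    LinearMap.lTensor (MvPolynomial σ K) (aeval y).toLinearMap) h
  simp only [Function.comp_apply, map_sum, map_sub, map_zero, LinearMap.lTensor_tmul,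
    AlgHom.toLinearMap_apply, TensorProduct.rid_tmul, Finset.sum_sub_distrib, sub_eq_zero,
    aeval_eq_eval] at h'
  rw [h', Finset.mul_sum]
  refine Finset.sum_congr rfl fun i _ => ?_
  rw [mul_smul_comm, mul_comm]

end MvPolynomial

/-- **No finite-sum solutions to the CKP Hirota equation.**
If `P` in the CKP Fock space `R = MvPolynomial ℕ ℂ` satisfies the algebraic Hirota equation
`S (P ⊗ P) = 0`, i.e. `∑_{a∈ℕ} ((∂_a P) ⊗ (X_a·P) − (X_a·P) ⊗ (∂_a P)) = 0`,
then `P` is a constant polynomial. -/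
theorem ckp_hirota_no_finite_solutions (P : MvPolynomial ℕ ℂ)
    (h : ∑ᶠ a : ℕ,
        ((pderiv a P) ⊗ₜ[ℂ] (X a * P) - (X a * P) ⊗ₜ[ℂ] (pderiv a P)
          : MvPolynomial ℕ ℂ ⊗[ℂ] MvPolynomial ℕ ℂ) = 0) :
    ∃ c : ℂ, P = C c := by
  rw [finsum_eq_sum_of_support_subset (s := P.vars) _ (fun a ha => by
    contrapose! ha
    simp [pderiv_eq_zero_of_notMem_vars ha])] at h
  rcases eq_or_ne P 0 with rfl | hP
  · exact ⟨0, C_0.symm⟩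
  refine exists_eq_C_of_forall_pderiv_eq_zero fun a ha => MvPolynomial.funext fun y => ?_
  have hy := sum_eval_smul_pderiv_eq_mul P P.vars h y
  have hcoeff := coeff_single_sum_smul_X P.vars (fun b => eval y (pderiv b P)) ha
  set L : MvPolynomial ℕ ℂ := ∑ b ∈ P.vars, eval y (pderiv b P) • X b
  rw [map_zero]
  by_contra hne
  rw [← hcoeff] at hne
  have hL : L ≠ 0 := fun h0 => hne (by rw [h0, coeff_zero])
  have hL_deg : 1 ≤ L.totalDegree := by
    simpa using le_totalDegree (mem_support_iff.2 hne)
  have hle : (P * L).totalDegree ≤ P.totalDegree := by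
    rw [← hy]
    exact totalDegree_finsetSum_le fun b _ =>
      (totalDegree_smul_le _ _).trans (totalDegree_pderiv_le b P)
  rw [totalDegree_mul_of_isDomain hP hL] at hle
  omega
end

section
/- For all m, n ∈ ℤ let E_{m,n} := −:χ̂_m χ̂_n: (these operators realize the action of the Lie algebra c_∞ on the CKP Fock space F_χ with central element acting by −1/2). Then the Hirota operator commutes with the diagonal action of c_∞: for all m, n ∈ ℤ and all v ∈ R ⊗[ℂ] R, (E_{m,n} ⊗ id + id ⊗ E_{m,n})(S v) = S((E_{m,n} ⊗ id + id ⊗ E_{m,n}) v). Moreover S(1 ⊗ 1) = 0. -/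
open MvPolynomial TensorProduct

/-- The mode `χ̂_m` of the CKP generating field `χ(z)` acting on the Fock space
`R = MvPolynomial ℕ ℂ`: for `m ≥ 0` it is `(−1)^m • ∂_{X_m}`, and for `m < 0` it is
multiplication by `X_{−m−1}`. -/
noncomputable def chiHat (m : ℤ) : MvPolynomial ℕ ℂ →ₗ[ℂ] MvPolynomial ℕ ℂ :=
  if 0 ≤ m then ((-1 : ℂ) ^ m.toNat) • (pderiv (R := ℂ) m.toNat).toLinearMap
  else LinearMap.mulLeft ℂ (X (-m - 1).toNat)

/-- Normal ordering `:χ̂_m χ̂_n:`. -/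
noncomputable def normalOrder (m n : ℤ) : MvPolynomial ℕ ℂ →ₗ[ℂ] MvPolynomial ℕ ℂ :=
  if 0 ≤ m ∧ n < 0 then chiHat n ∘ₗ chiHat m else chiHat m ∘ₗ chiHat n

/-- The operator `E_{m,n} = −:χ̂_m χ̂_n:`, realizing the action of `c_∞` on the CKP Fock
space. -/
noncomputable def Eop (m n : ℤ) : MvPolynomial ℕ ℂ →ₗ[ℂ] MvPolynomial ℕ ℂ :=
  -(normalOrder m n)

/-- The Hirota operator `S = Res_z χ(z) ⊗ χ(−z)` acting on `R ⊗[ℂ] R`. -/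
noncomputable def hirotaS (v : MvPolynomial ℕ ℂ ⊗[ℂ] MvPolynomial ℕ ℂ) :
    MvPolynomial ℕ ℂ ⊗[ℂ] MvPolynomial ℕ ℂ :=
  ∑ᶠ a : ℕ, ((-1 : ℂ) ^ a) •
    ((TensorProduct.map (chiHat (a : ℤ)) (chiHat (-(a : ℤ) - 1)) -
      TensorProduct.map (chiHat (-(a : ℤ) - 1)) (chiHat (a : ℤ))) v)

/-- The form `∂_a ⊗ X_a - X_a ⊗ ∂_a` of the `a`-th summand of the Hirota operator. -/
noncomputable def hirotaTerm (a : ℕ) :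
    Module.End ℂ (MvPolynomial ℕ ℂ ⊗[ℂ] MvPolynomial ℕ ℂ) :=
  TensorProduct.map (pderiv (R := ℂ) a).toLinearMap (LinearMap.mulLeft ℂ (X a)) -
    TensorProduct.map (LinearMap.mulLeft ℂ (X a)) (pderiv (R := ℂ) a).toLinearMap

theorem chiHat_natCast_apply (a : ℕ) (f : MvPolynomial ℕ ℂ) :
    chiHat (a : ℤ) f = ((-1 : ℂ) ^ a) • pderiv a f := by
  simp [chiHat]

theorem chiHat_neg_natCast_sub_one_apply (a : ℕ) (f : MvPolynomial ℕ ℂ) :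
    chiHat (-(a : ℤ) - 1) f = X a * f := by
  have h : ¬ (0 : ℤ) ≤ -(a : ℤ) - 1 := by omega
  have h' : (-(-(a : ℤ) - 1) - 1).toNat = a := by omega
  simp only [chiHat, if_neg h, h', LinearMap.mulLeft_apply]

theorem hirotaTerm_tmul (a : ℕ) (f g : MvPolynomial ℕ ℂ) :
    hirotaTerm a (f ⊗ₜ[ℂ] g) = pderiv a f ⊗ₜ (X a * g) - (X a * f) ⊗ₜ pderiv a g := by
  simp [hirotaTerm]

theorem smul_map_chiHat_eq_hirotaTerm (a : ℕ) :
    ((-1 : ℂ) ^ a) • (TensorProduct.map (chiHat (a : ℤ)) (chiHat (-(a : ℤ) - 1)) -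
      TensorProduct.map (chiHat (-(a : ℤ) - 1)) (chiHat (a : ℤ))) = hirotaTerm a := by
  have h : ((-1 : ℂ) ^ a) * (-1) ^ a = 1 := by rw [← mul_pow]; simp
  refine TensorProduct.ext' fun f g => ?_
  simp only [LinearMap.smul_apply, LinearMap.sub_apply, TensorProduct.map_tmul,
    chiHat_natCast_apply, chiHat_neg_natCast_sub_one_apply, hirotaTerm_tmul,
    ← TensorProduct.smul_tmul', TensorProduct.tmul_smul, smul_sub, smul_smul, h, one_smul]

theorem exists_forall_hirotaTerm_eq_zero (v : MvPolynomial ℕ ℂ ⊗[ℂ] MvPolynomial ℕ ℂ) :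
    ∃ N, ∀ a ≥ N, hirotaTerm a v = 0 := by
  induction v with
  | zero => exact ⟨0, fun _ _ => map_zero _⟩
  | tmul f g =>
    refine ⟨(f.vars ∪ g.vars).sup id + 1, fun a ha => ?_⟩
    have h : a ∉ f.vars ∪ g.vars := fun h => by
      have : a ≤ (f.vars ∪ g.vars).sup id := Finset.le_sup (f := id) h
      omega
    rw [Finset.mem_union, not_or] at h
    rw [hirotaTerm_tmul, pderiv_eq_zero_of_notMem_vars h.1, pderiv_eq_zero_of_notMem_vars h.2]
    simp
  | add v w hv hw =>
    obtain ⟨N, hN⟩ := hv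
    obtain ⟨M, hM⟩ := hw
    refine ⟨max N M, fun a ha => ?_⟩
    rw [map_add, hN a (le_of_max_le_left ha), hM a (le_of_max_le_right ha), add_zero]

theorem exists_forall_hirotaS_eq_sum (v : MvPolynomial ℕ ℂ ⊗[ℂ] MvPolynomial ℕ ℂ) :
    ∃ N, ∀ M ≥ N, hirotaS v = (∑ a ∈ Finset.range M, hirotaTerm a) v := by
  obtain ⟨N, hN⟩ := exists_forall_hirotaTerm_eq_zero v
  refine ⟨N, fun M hM => ?_⟩
  have h : hirotaS v = ∑ᶠ a : ℕ, hirotaTerm a v :=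
    finsum_congr fun a => by rw [← smul_map_chiHat_eq_hirotaTerm, LinearMap.smul_apply]
  rw [h, LinearMap.sum_apply]
  refine finsum_eq_sum_of_support_subset _ fun a ha => ?_
  rw [Finset.coe_range, Set.mem_Iio]
  by_contra! hMa
  exact ha (hN a (hM.trans hMa))

theorem pderiv_X_mul (a b : ℕ) (f : MvPolynomial ℕ ℂ) :
    pderiv a (X b * f) = X b * pderiv a f + if b = a then f else 0 := by
  rw [pderiv_mul, pderiv_X, add_comm]
  congr 1
  split_ifs with h
  · subst h; simp
  · simp [Pi.single_eq_of_ne h]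

theorem pderiv_comm (a b : ℕ) (f : MvPolynomial ℕ ℂ) :
    pderiv a (pderiv b f) = pderiv b (pderiv a f) := by
  have h : ⁅pderiv (R := ℂ) a, pderiv (R := ℂ) b⁆ = 0 := by
    refine derivation_ext fun i => ?_
    simp [Derivation.commutator_apply, pderiv_X, Pi.single_apply, apply_ite]
  exact sub_eq_zero.mp (by simpa [Derivation.commutator_apply] using DFunLike.congr_fun h f)

/-- The variable index on which `χ̂_m` acts. -/
def chiIndex (m : ℤ) : ℕ := if 0 ≤ m then m.toNat else (-m - 1).toNat

/-- The action `c ↦ c ⊗ id` of endomorphisms of the Fock space on the left tensor factor. -/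
noncomputable abbrev actLeft : Module.End ℂ (MvPolynomial ℕ ℂ) →ₐ[ℂ]
    Module.End ℂ (MvPolynomial ℕ ℂ ⊗[ℂ] MvPolynomial ℕ ℂ) :=
  Module.End.rTensorAlgHom ℂ _ _

/-- The action `c ↦ id ⊗ c` of endomorphisms of the Fock space on the right tensor factor. -/
noncomputable abbrev actRight : Module.End ℂ (MvPolynomial ℕ ℂ) →ₐ[ℂ]
    Module.End ℂ (MvPolynomial ℕ ℂ ⊗[ℂ] MvPolynomial ℕ ℂ) :=
  Module.End.lTensorAlgHom ℂ _ _

theorem actLeft_tmul (c : Module.End ℂ (MvPolynomial ℕ ℂ)) (f g : MvPolynomial ℕ ℂ) :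
    actLeft c (f ⊗ₜ[ℂ] g) = c f ⊗ₜ g :=
  LinearMap.rTensor_tmul _ _ _ _

theorem actRight_tmul (c : Module.End ℂ (MvPolynomial ℕ ℂ)) (f g : MvPolynomial ℕ ℂ) :
    actRight c (f ⊗ₜ[ℂ] g) = f ⊗ₜ c g :=
  LinearMap.lTensor_tmul _ _ _ _

theorem hirotaTerm_mul_actLeft_pderiv (a b : ℕ) :
    hirotaTerm a * actLeft (pderiv (R := ℂ) b).toLinearMap =
      actLeft (pderiv (R := ℂ) b).toLinearMap * hirotaTerm a +
        if b = a then actRight (pderiv (R := ℂ) b).toLinearMap else 0 := by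
  refine TensorProduct.ext' fun f g => ?_
  by_cases h : b = a
  · subst h
    simp only [Module.End.mul_apply, LinearMap.add_apply, actLeft_tmul, actRight_tmul,
      hirotaTerm_tmul, map_sub, Derivation.coeFn_coe,
      pderiv_X_mul, if_true, TensorProduct.add_tmul]
    abel
  · simp only [Module.End.mul_apply, actLeft_tmul,
      hirotaTerm_tmul, map_sub, Derivation.coeFn_coe,
      pderiv_X_mul, pderiv_comm b a, if_neg h, if_neg (Ne.symm h), add_zero]

theorem hirotaTerm_mul_actRight_pderiv (a b : ℕ) :
    (hirotaTerm a * actRight (pderiv (R := ℂ) b).toLinearMap +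
        if b = a then actLeft (pderiv (R := ℂ) b).toLinearMap else 0) =
      actRight (pderiv (R := ℂ) b).toLinearMap * hirotaTerm a := by
  refine TensorProduct.ext' fun f g => ?_
  by_cases h : b = a
  · subst h
    simp only [Module.End.mul_apply, LinearMap.add_apply, actLeft_tmul, actRight_tmul,
      hirotaTerm_tmul, map_sub, Derivation.coeFn_coe,
      pderiv_X_mul, if_true, TensorProduct.tmul_add]
    abel
  · simp only [Module.End.mul_apply, actRight_tmul,
      hirotaTerm_tmul, map_sub, Derivation.coeFn_coe,
      pderiv_X_mul, pderiv_comm b a, if_neg h, if_neg (Ne.symm h), add_zero]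

theorem hirotaTerm_mul_actLeft_mulLeft_X (a b : ℕ) :
    hirotaTerm a * actLeft (LinearMap.mulLeft ℂ (X b)) =
      actLeft (LinearMap.mulLeft ℂ (X b)) * hirotaTerm a +
        if b = a then actRight (LinearMap.mulLeft ℂ (X b)) else 0 := by
  refine TensorProduct.ext' fun f g => ?_
  by_cases h : b = a
  · subst h
    simp only [Module.End.mul_apply, LinearMap.add_apply, actLeft_tmul, actRight_tmul,
      hirotaTerm_tmul, map_sub, LinearMap.mulLeft_apply, pderiv_X_mul, if_true,
      TensorProduct.add_tmul]
    abel
  · simp only [Module.End.mul_apply, actLeft_tmul, hirotaTerm_tmul, map_sub,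
      LinearMap.mulLeft_apply, pderiv_X_mul, if_neg h, add_zero,
      mul_left_comm (X a) (X b)]

theorem hirotaTerm_mul_actRight_mulLeft_X (a b : ℕ) :
    (hirotaTerm a * actRight (LinearMap.mulLeft ℂ (X b)) +
        if b = a then actLeft (LinearMap.mulLeft ℂ (X b)) else 0) =
      actRight (LinearMap.mulLeft ℂ (X b)) * hirotaTerm a := by
  refine TensorProduct.ext' fun f g => ?_
  by_cases h : b = a
  · subst h
    simp only [Module.End.mul_apply, LinearMap.add_apply, actLeft_tmul, actRight_tmul,
      hirotaTerm_tmul, map_sub, LinearMap.mulLeft_apply, pderiv_X_mul, if_true,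
      TensorProduct.tmul_add]
    abel
  · simp only [Module.End.mul_apply, actRight_tmul, hirotaTerm_tmul, map_sub,
      LinearMap.mulLeft_apply, pderiv_X_mul, if_neg h, add_zero,
      mul_left_comm (X a) (X b)]

theorem hirotaTerm_mul_actLeft_chiHat (a : ℕ) (m : ℤ) :
    hirotaTerm a * actLeft (chiHat m) =
      actLeft (chiHat m) * hirotaTerm a + if chiIndex m = a then actRight (chiHat m) else 0 := by
  by_cases hm : 0 ≤ m
  · simp only [chiHat, chiIndex, if_pos hm, map_smul, mul_smul_comm, smul_mul_assoc,
      hirotaTerm_mul_actLeft_pderiv, smul_add, smul_ite, smul_zero]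
  · simp only [chiHat, chiIndex, if_neg hm, hirotaTerm_mul_actLeft_mulLeft_X]

theorem hirotaTerm_mul_actRight_chiHat (a : ℕ) (m : ℤ) :
    (hirotaTerm a * actRight (chiHat m) + if chiIndex m = a then actLeft (chiHat m) else 0) =
      actRight (chiHat m) * hirotaTerm a := by
  by_cases hm : 0 ≤ m
  · simp only [chiHat, chiIndex, if_pos hm, map_smul, mul_smul_comm, smul_mul_assoc,
      ← hirotaTerm_mul_actRight_pderiv, smul_add, smul_ite, smul_zero]
  · simp only [chiHat, chiIndex, if_neg hm, ← hirotaTerm_mul_actRight_mulLeft_X]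

theorem sum_hirotaTerm_mul_actLeft_chiHat {N : ℕ} {m : ℤ} (h : chiIndex m < N) :
    (∑ a ∈ Finset.range N, hirotaTerm a) * actLeft (chiHat m) =
      actLeft (chiHat m) * (∑ a ∈ Finset.range N, hirotaTerm a) + actRight (chiHat m) := by
  simp only [Finset.sum_mul, hirotaTerm_mul_actLeft_chiHat, Finset.sum_add_distrib,
    Finset.mul_sum, Finset.sum_ite_eq, Finset.mem_range, if_pos h]

theorem sum_hirotaTerm_mul_actRight_chiHat {N : ℕ} {m : ℤ} (h : chiIndex m < N) :
    (∑ a ∈ Finset.range N, hirotaTerm a) * actRight (chiHat m) + actLeft (chiHat m) =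
      actRight (chiHat m) * (∑ a ∈ Finset.range N, hirotaTerm a) := by
  simp only [Finset.sum_mul, ← hirotaTerm_mul_actRight_chiHat, Finset.sum_add_distrib,
    Finset.mul_sum, Finset.sum_ite_eq, Finset.mem_range, if_pos h]

/-- If `[S, x] = x'`, `[S, x'] = -x` and likewise for `y`, then `S` commutes with
`x y + x' y'`. -/
theorem commute_mul_add_mul_of_rotation {A : Type*} [Semiring A] {S x x' y y' : A}
    (hx : S * x = x * S + x') (hx' : S * x' + x = x' * S)
    (hy : S * y = y * S + y') (hy' : S * y' + y = y' * S) :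
    Commute S (x * y + x' * y') := by
  have h : S * (x * y) = x * y * S + (x * y' + x' * y) := by
    rw [← mul_assoc, hx, add_mul, mul_assoc, hy, mul_add, mul_assoc, add_assoc]
  have h' : x' * y' * S = (x * y' + x' * y) + S * (x' * y') := by
    rw [mul_assoc, ← hy', mul_add, ← mul_assoc, ← hx', add_mul, mul_assoc]
    abel
  rw [commute_iff_eq, mul_add, add_mul, h, h', add_assoc]

theorem commute_sum_hirotaTerm_chiHat_mul {N : ℕ} {m n : ℤ} (hm : chiIndex m < N)
    (hn : chiIndex n < N) :
    Commute (∑ a ∈ Finset.range N, hirotaTerm a)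
      (actLeft (chiHat m * chiHat n) + actRight (chiHat m * chiHat n)) := by
  rw [map_mul, map_mul]
  exact commute_mul_add_mul_of_rotation
    (sum_hirotaTerm_mul_actLeft_chiHat hm) (sum_hirotaTerm_mul_actRight_chiHat hm)
    (sum_hirotaTerm_mul_actLeft_chiHat hn) (sum_hirotaTerm_mul_actRight_chiHat hn)

theorem commute_sum_hirotaTerm_Eop {N : ℕ} {m n : ℤ} (hm : chiIndex m < N)
    (hn : chiIndex n < N) :
    Commute (∑ a ∈ Finset.range N, hirotaTerm a) (actLeft (Eop m n) + actRight (Eop m n)) := by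
  rw [Eop, ← neg_one_smul ℂ, map_smul, map_smul, ← smul_add, normalOrder]
  split_ifs
  · exact (commute_sum_hirotaTerm_chiHat_mul hn hm).smul_right _
  · exact (commute_sum_hirotaTerm_chiHat_mul hm hn).smul_right _

/-- **The Hirota operator commutes with the diagonal action of `c_∞`,** and kills the
vacuum `1 ⊗ 1`. -/
theorem ckp_hirota_commutes_with_cInfinity :
    (∀ (m n : ℤ) (v : MvPolynomial ℕ ℂ ⊗[ℂ] MvPolynomial ℕ ℂ),
      (TensorProduct.map (Eop m n) (LinearMap.id : MvPolynomial ℕ ℂ →ₗ[ℂ] MvPolynomial ℕ ℂ)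
        + TensorProduct.map (LinearMap.id : MvPolynomial ℕ ℂ →ₗ[ℂ] MvPolynomial ℕ ℂ) (Eop m n))
          (hirotaS v)
        = hirotaS
          ((TensorProduct.map (Eop m n) (LinearMap.id : MvPolynomial ℕ ℂ →ₗ[ℂ] MvPolynomial ℕ ℂ)
            + TensorProduct.map (LinearMap.id : MvPolynomial ℕ ℂ →ₗ[ℂ] MvPolynomial ℕ ℂ)
                (Eop m n)) v)) ∧
    hirotaS ((1 : MvPolynomial ℕ ℂ) ⊗ₜ[ℂ] (1 : MvPolynomial ℕ ℂ)) = 0 := by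
  refine ⟨fun m n v => ?_, ?_⟩
  · obtain ⟨N₁, h₁⟩ := exists_forall_hirotaS_eq_sum v
    obtain ⟨N₂, h₂⟩ := exists_forall_hirotaS_eq_sum
      ((actLeft (Eop m n) + actRight (Eop m n)) v)
    set M := N₁ + N₂ + chiIndex m + chiIndex n + 1 with hM
    have hc := commute_sum_hirotaTerm_Eop (N := M) (m := m) (n := n) (by omega) (by omega)
    change (actLeft (Eop m n) + actRight (Eop m n)) (hirotaS v) =
      hirotaS ((actLeft (Eop m n) + actRight (Eop m n)) v)
    rw [h₁ M (by omega), h₂ M (by omega)]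
    exact (LinearMap.congr_fun hc.eq v).symm
  · obtain ⟨N, hN⟩ := exists_forall_hirotaS_eq_sum (1 ⊗ₜ 1)
    rw [hN N le_rfl, LinearMap.sum_apply]
    exact Finset.sum_eq_zero fun a _ => by simp [hirotaTerm_tmul]
end

section
/- The operators Ĥ_a satisfy the commutation relations of the twisted Heisenberg algebra ℋ_{ℤ+1/2} with negative-definite form: for all a, b ∈ ℤ, Ĥ_a ∘ Ĥ_b − Ĥ_b ∘ Ĥ_a = −(a + 1/2) • id if a + b + 1 = 0, and Ĥ_a ∘ Ĥ_b − Ĥ_b ∘ Ĥ_a = 0 otherwise. (That is, the modes h^t_m, m ∈ ℤ+1/2, of the twisted Heisenberg field constructed from the CKP field χ(z) satisfy [h^t_m, h^t_n] = −m δ_{m+n,0}·1.) -/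
open MvPolynomial

/-- The twisted Heisenberg mode `Ĥ_a = (1/2) ∑_{c∈ℤ} (−1)^{c+1} χ̂_{2a−c} ∘ χ̂_c`,
realizing the mode `h^t_{a+1/2}` of the twisted Heisenberg field
`h^{ℤ+1/2}_χ(z) = (1/2):χ(z)χ(−z):`. -/
noncomputable def Hhat (a : ℤ) (P : MvPolynomial ℕ ℂ) : MvPolynomial ℕ ℂ :=
  (1/2 : ℂ) • ∑ᶠ c : ℤ, (-1 : ℂ) ^ (c + 1) • chiHat (2*a - c) (chiHat c P)

theorem pderiv_pderiv_comm {σ R : Type*} [CommRing R] (i j : σ) (P : MvPolynomial σ R) :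
    pderiv i (pderiv j P) = pderiv j (pderiv i P) := by
  classical
  have h : ⁅pderiv (R := R) i, pderiv (R := R) j⁆ = 0 := by
    refine MvPolynomial.derivation_ext fun k => ?_
    simp [Derivation.commutator_apply, pderiv_X, Pi.single_apply, apply_ite]
  simpa [Derivation.commutator_apply, sub_eq_zero] using congrArg (fun D => D P) h

/-- The generating modes satisfy the canonical commutation relations. -/
theorem chiHat_comm (m n : ℤ) (P : MvPolynomial ℕ ℂ) :
    chiHat m (chiHat n P) =
      chiHat n (chiHat m P) + (if m + n + 1 = 0 then (-1 : ℂ) ^ m else 0) • P := by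
  rcases le_or_gt 0 m with hm | hm <;> rcases le_or_gt 0 n with hn | hn
  · have h : m + n + 1 ≠ 0 := by omega
    simp only [chiHat, hm, hn, h, if_true, if_false, LinearMap.smul_apply,
      Derivation.coeFn_coe, map_smul, zero_smul, add_zero]
    rw [smul_comm, pderiv_pderiv_comm]
  · obtain ⟨k, rfl⟩ := Int.eq_ofNat_of_zero_le hm
    obtain ⟨l, rfl⟩ := Int.eq_negSucc_of_lt_zero hn
    have hl : (-(Int.negSucc l) - 1).toNat = l := by omega
    simp only [chiHat, hm, hn.not_ge, hl, if_true, if_false, LinearMap.smul_apply,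
      Derivation.coeFn_coe, LinearMap.mulLeft_apply, Derivation.leibniz, pderiv_X, smul_add,
      Int.toNat_natCast, smul_eq_mul, zpow_natCast]
    by_cases h : l = k
    · subst h
      have h' : (l : ℤ) + Int.negSucc l + 1 = 0 := by omega
      simp [h']
    · have h' : (k : ℤ) + Int.negSucc l + 1 ≠ 0 := by omega
      simp [h', h]
  · obtain ⟨k, rfl⟩ := Int.eq_ofNat_of_zero_le hn
    obtain ⟨l, rfl⟩ := Int.eq_negSucc_of_lt_zero hm
    have hl : (-(Int.negSucc l) - 1).toNat = l := by omega
    simp only [chiHat, hn, hm.not_ge, hl, if_true, if_false, LinearMap.smul_apply,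
      Derivation.coeFn_coe, LinearMap.mulLeft_apply, Derivation.leibniz, pderiv_X, smul_add,
      Int.toNat_natCast, smul_eq_mul]
    by_cases h : l = k
    · subst h
      have h' : Int.negSucc l + (l : ℤ) + 1 = 0 := by omega
      have hinv : ((-1 : ℂ) ^ l)⁻¹ = (-1) ^ l := by rw [← inv_pow, inv_neg_one]
      simp [h', zpow_negSucc, pow_succ, add_assoc, hinv]
    · have h' : Int.negSucc l + (k : ℤ) + 1 ≠ 0 := by omega
      simp [h', h]
  · have h : m + n + 1 ≠ 0 := by omega
    simp only [chiHat, hm.not_ge, hn.not_ge, h, if_false, LinearMap.mulLeft_apply, zero_smul,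
      add_zero]
    ring

theorem chiHat_one {m : ℤ} (hm : 0 ≤ m) : chiHat m 1 = 0 := by
  simp [chiHat, hm]

theorem chiHat_negSucc (n : ℕ) (P : MvPolynomial ℕ ℂ) :
    chiHat (Int.negSucc n) P = X n * P := by
  have h : (-(Int.negSucc n) - 1).toNat = n := by omega
  rw [chiHat, if_neg (by omega), h, LinearMap.mulLeft_apply]

theorem constantCoeff_chiHat {m : ℤ} (hm : m < 0) (P : MvPolynomial ℕ ℂ) :
    constantCoeff (chiHat m P) = 0 := by
  simp [chiHat, hm.not_ge]

theorem exists_chiHat_eq_zero (P : MvPolynomial ℕ ℂ) :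
    ∃ N : ℤ, ∀ m, N ≤ m → chiHat m P = 0 := by
  refine ⟨P.vars.sup id + 1, fun m hm => ?_⟩
  have h0 : 0 ≤ m := by omega
  have hv : m.toNat ∉ P.vars := fun h => by
    have : m.toNat ≤ P.vars.sup id := Finset.le_sup (f := id) h
    omega
  simp [chiHat, h0, pderiv_eq_zero_of_notMem_vars hv]

/-- Modes whose indices have an even sum commute. -/
theorem chiHat_comm_even (a c : ℤ) (P : MvPolynomial ℕ ℂ) :
    chiHat (2 * a - c) (chiHat c P) = chiHat c (chiHat (2 * a - c) P) := by
  have h : 2 * a - c + c + 1 ≠ 0 := by omega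
  rw [chiHat_comm, if_neg h, zero_smul, add_zero]

theorem finite_support_Hhat (a : ℤ) (P : MvPolynomial ℕ ℂ) :
    (Function.support fun c : ℤ =>
      (-1 : ℂ) ^ (c + 1) • chiHat (2 * a - c) (chiHat c P)).Finite := by
  obtain ⟨N, hN⟩ := exists_chiHat_eq_zero P
  refine (Set.finite_Icc (2 * a - N) N).subset fun c hc => ?_
  by_contra h
  rw [Set.mem_Icc, not_and_or, not_le, not_le] at h
  refine hc ?_
  rcases h with h | h
  · simp [chiHat_comm_even, hN (2 * a - c) (by omega)]
  · simp [hN c h.le]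

/-- The twisted Heisenberg mode `Hhat a` as a linear map. -/
noncomputable def HhatLinear (a : ℤ) : MvPolynomial ℕ ℂ →ₗ[ℂ] MvPolynomial ℕ ℂ where
  toFun := Hhat a
  map_add' P Q := by
    simp only [Hhat, map_add, smul_add]
    rw [finsum_add_distrib (finite_support_Hhat a P) (finite_support_Hhat a Q), smul_add]
  map_smul' r P := by
    simp only [Hhat, map_smul, RingHom.id_apply]
    rw [smul_comm r, smul_finsum' r (finite_support_Hhat a P)]
    simp only [smul_comm r]

theorem HhatLinear_apply (a : ℤ) (P : MvPolynomial ℕ ℂ) : HhatLinear a P = Hhat a P := rfl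

theorem map_Hhat {M : Type*} [AddCommGroup M] [Module ℂ M] (f : MvPolynomial ℕ ℂ →ₗ[ℂ] M)
    (a : ℤ) (P : MvPolynomial ℕ ℂ) :
    f (Hhat a P) =
      (1 / 2 : ℂ) • ∑ᶠ c : ℤ, (-1 : ℂ) ^ (c + 1) • f (chiHat (2 * a - c) (chiHat c P)) := by
  rw [Hhat, map_smul]
  congr 1
  refine (f.toAddMonoidHom.map_finsum (finite_support_Hhat a P)).trans ?_
  simp

theorem neg_one_zpow_mul_self (c : ℤ) : (-1 : ℂ) ^ c * (-1) ^ c = 1 := by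
  rw [← mul_zpow]
  simp

/-- The Heisenberg modes act on the generating modes by index shifts. -/
theorem Hhat_chiHat (a m : ℤ) (P : MvPolynomial ℕ ℂ) :
    Hhat a (chiHat m P) = chiHat m (Hhat a P) - chiHat (m + 2 * a + 1) P := by
  set Q := chiHat (m + 2 * a + 1) P with hQ
  have key : ∀ c : ℤ, (-1 : ℂ) ^ (c + 1) • chiHat (2 * a - c) (chiHat c (chiHat m P)) =
      (-1 : ℂ) ^ (c + 1) • chiHat m (chiHat (2 * a - c) (chiHat c P)) +
        ((if c = -m - 1 then -Q else 0) + (if c = m + 2 * a + 1 then -Q else 0)) := by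
    intro c
    rw [chiHat_comm c m, map_add, chiHat_comm (2 * a - c) m, smul_add, smul_add, add_assoc,
      map_smul, add_comm (_ • (_ • chiHat c P))]
    have hs : (-1 : ℂ) ^ (2 * a - c) = (-1) ^ c := by
      rw [zpow_sub₀ (by norm_num), zpow_mul]
      have := neg_one_zpow_mul_self c
      field_simp
      simp [pow_two, this]
    have hm : (-1 : ℂ) ^ (c + 1) * (-1) ^ c = -1 := by
      rw [zpow_add_one₀ (by norm_num), mul_right_comm, neg_one_zpow_mul_self]
      simp
    congr 2
    · by_cases h : c = -m - 1
      · rw [if_pos h, if_pos (by omega), smul_smul, hm, neg_one_smul, hQ]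
        congr 3
        omega
      · rw [if_neg h, if_neg (by omega), zero_smul, smul_zero]
    · by_cases h : c = m + 2 * a + 1
      · rw [if_pos h, if_pos (by omega), smul_smul, hs, hm, neg_one_smul, hQ, h]
      · rw [if_neg h, if_neg (by omega), zero_smul, smul_zero]
  have hfin : ∀ d : ℤ, (Function.support fun c : ℤ => if c = d then -Q else 0).Finite :=
    fun d => (Set.finite_singleton d).subset fun c hc => by
      by_contra h
      exact hc (if_neg h)
  have hsum : ∀ d : ℤ, (∑ᶠ c : ℤ, if c = d then -Q else 0) = -Q := fun d => by
    rw [finsum_eq_single _ d fun c hc => if_neg hc, if_pos rfl]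
  have hfin' : (Function.support fun c : ℤ =>
      (-1 : ℂ) ^ (c + 1) • chiHat m (chiHat (2 * a - c) (chiHat c P))).Finite :=
    (finite_support_Hhat a P).subset fun c hc h => hc (by
      simpa using congrArg (chiHat m) h)
  rw [map_Hhat, Hhat, finsum_congr key, finsum_add_distrib hfin', finsum_add_distrib (hfin _)
    (hfin _), hsum, hsum, smul_add, sub_eq_add_neg, ← two_smul ℂ (-Q), smul_smul]
  · norm_num
  · exact ((hfin _).union (hfin _)).subset (Function.support_add _ _)

/-- The commutator of two twisted Heisenberg modes. -/
noncomputable def HhatBracket (a b : ℤ) : MvPolynomial ℕ ℂ →ₗ[ℂ] MvPolynomial ℕ ℂ :=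
  HhatLinear a ∘ₗ HhatLinear b - HhatLinear b ∘ₗ HhatLinear a

theorem HhatBracket_apply (a b : ℤ) (P : MvPolynomial ℕ ℂ) :
    HhatBracket a b P = Hhat a (Hhat b P) - Hhat b (Hhat a P) := rfl

theorem HhatBracket_chiHat (a b m : ℤ) (P : MvPolynomial ℕ ℂ) :
    HhatBracket a b (chiHat m P) = chiHat m (HhatBracket a b P) := by
  have h : ∀ a b : ℤ, Hhat a (Hhat b (chiHat m P)) =
      chiHat m (Hhat a (Hhat b P)) - chiHat (m + 2 * a + 1) (Hhat b P) -
        chiHat (m + 2 * b + 1) (Hhat a P) + chiHat (m + 2 * a + 2 * b + 2) P := by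
    intro a b
    rw [Hhat_chiHat, ← HhatLinear_apply a, map_sub, HhatLinear_apply, HhatLinear_apply,
      Hhat_chiHat, Hhat_chiHat a, show m + 2 * b + 1 + 2 * a + 1 = m + 2 * a + 2 * b + 2 by ring]
    abel
  rw [HhatBracket_apply, HhatBracket_apply, h, h, map_sub,
    show m + 2 * b + 2 * a + 2 = m + 2 * a + 2 * b + 2 by ring]
  abel

theorem eq_C_of_pderiv_eq_zero {σ R : Type*} [CommRing R] [IsDomain R] [CharZero R]
    {P : MvPolynomial σ R} (h : ∀ i, pderiv i P = 0) : P = C (constantCoeff P) := by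
  classical
  ext s
  rw [coeff_C]
  split_ifs with hs
  · rw [← hs, constantCoeff_eq]
  · obtain ⟨i, hi⟩ := Finsupp.ne_iff.mp (Ne.symm hs)
    have hle : Finsupp.single i 1 ≤ s := by
      rw [Finsupp.single_le_iff]
      exact Nat.one_le_iff_ne_zero.mpr hi
    have := congrArg (coeff (s - Finsupp.single i 1)) (h i)
    rw [coeff_pderiv, tsub_add_cancel_of_le hle, coeff_zero] at this
    exact (mul_eq_zero.mp this).resolve_right (Nat.cast_add_one_ne_zero _)

/-- The commutator of two modes is the scalar given by its vacuum expectation value. -/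
theorem HhatBracket_eq_smul (a b : ℤ) (P : MvPolynomial ℕ ℂ) :
    HhatBracket a b P = constantCoeff (HhatBracket a b 1) • P := by
  have h1 : HhatBracket a b 1 = C (constantCoeff (HhatBracket a b 1)) := by
    refine eq_C_of_pderiv_eq_zero fun i => ?_
    have h := HhatBracket_chiHat a b i 1
    rw [chiHat_one (by omega), map_zero] at h
    simpa [chiHat] using h.symm
  induction P using MvPolynomial.induction_on with
  | C r =>
    rw [C_eq_smul_one, map_smul, smul_comm]
    congr 1
    rw [← C_eq_smul_one]
    exact h1
  | add P Q hP hQ => rw [map_add, hP, hQ, smul_add]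
  | mul_X P n hP =>
    rw [mul_comm, ← chiHat_negSucc, HhatBracket_chiHat, hP, map_smul]

theorem Hhat_one {a : ℤ} (ha : 0 ≤ a) : Hhat a 1 = 0 := by
  rw [Hhat, finsum_eq_zero_of_forall_eq_zero, smul_zero]
  intro c
  rcases le_or_gt 0 c with hc | hc
  · simp [chiHat_one hc]
  · simp [chiHat_comm_even, chiHat_one (show 0 ≤ 2 * a - c by omega)]

theorem constantCoeff_Hhat {a : ℤ} (ha : a < 0) (P : MvPolynomial ℕ ℂ) :
    constantCoeff (Hhat a P) = 0 := by
  have h := map_Hhat (lcoeff ℂ 0) a P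
  rw [finsum_eq_zero_of_forall_eq_zero, smul_zero] at h
  · exact h
  intro c
  rw [lcoeff_apply, ← constantCoeff_eq]
  rcases le_or_gt 0 c with hc | hc
  · rw [constantCoeff_chiHat (by omega), smul_zero]
  · rw [chiHat_comm_even, constantCoeff_chiHat hc, smul_zero]

theorem constantCoeff_Hhat_Hhat_one {a b : ℤ} (ha : 0 ≤ a) (hb : b < 0) :
    constantCoeff (Hhat a (Hhat b 1)) = if a + b + 1 = 0 then -((a : ℂ) + 1 / 2) else 0 := by
  have h := map_Hhat (lcoeff ℂ 0 ∘ₗ HhatLinear a) b 1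
  simp only [LinearMap.comp_apply, lcoeff_apply, ← constantCoeff_eq, HhatLinear_apply] at h
  have key : ∀ c : ℤ,
      (-1 : ℂ) ^ (c + 1) • constantCoeff (Hhat a (chiHat (2 * b - c) (chiHat c 1))) =
        if c ∈ Finset.Ioo (2 * b) 0 then (if a + b + 1 = 0 then -1 else 0) else 0 := by
    intro c
    simp only [Finset.mem_Ioo]
    have h0 : Hhat a (0 : MvPolynomial ℕ ℂ) = 0 := map_zero (HhatLinear a)
    rcases le_or_gt 0 c with hc | hc
    · rw [if_neg (by omega), chiHat_one hc, map_zero, h0, map_zero, smul_zero]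
    rcases le_or_gt 0 (2 * b - c) with hd | hd
    · rw [if_neg (by omega), chiHat_comm_even, chiHat_one hd, map_zero, h0, map_zero, smul_zero]
    rw [if_pos (by omega), Hhat_chiHat, Hhat_chiHat, chiHat_comm (2 * b - c + 2 * a + 1) c,
      Hhat_one ha, map_zero, zero_sub, map_sub, map_add, constantCoeff_chiHat hd,
      constantCoeff_chiHat hc]
    by_cases hab : a + b + 1 = 0
    · have he : 2 * b - c + 2 * a + 1 = -(c + 1) := by omega
      rw [if_pos hab, if_pos (by omega), he, zpow_neg]
      simp [mul_inv_cancel₀ (zpow_ne_zero (c + 1) (neg_ne_zero.mpr (one_ne_zero (α := ℂ))))]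
    · rw [if_neg hab, if_neg (by omega)]
      simp
  rw [h, finsum_congr key, finsum_eq_sum_of_support_subset (s := Finset.Ioo (2 * b) 0)]
  · rw [Finset.sum_ite_mem, Finset.inter_self, Finset.sum_const, Int.card_Ioo]
    split_ifs with hab
    · obtain rfl : a = -b - 1 := by omega
      have hn : (((0 - 2 * b - 1).toNat : ℕ) : ℂ) = -2 * b - 1 := by
        have : (((0 - 2 * b - 1).toNat : ℕ) : ℤ) = -2 * b - 1 := by omega
        exact_mod_cast congrArg (Int.cast : ℤ → ℂ) this
      rw [nsmul_eq_mul, hn, smul_eq_mul]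
      push_cast
      ring
    · simp
  · intro c hc
    by_contra hn
    exact hc (if_neg hn)

theorem constantCoeff_HhatBracket_one (a b : ℤ) :
    constantCoeff (HhatBracket a b 1) =
      if a + b + 1 = 0 then -((a : ℂ) + 1 / 2) else 0 := by
  have h0 : ∀ d : ℤ, Hhat d (0 : MvPolynomial ℕ ℂ) = 0 := fun d => map_zero (HhatLinear d)
  rw [HhatBracket_apply, map_sub]
  rcases le_or_gt 0 a with ha | ha <;> rcases le_or_gt 0 b with hb | hb
  · rw [Hhat_one ha, Hhat_one hb, h0, h0, if_neg (by omega)]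
    simp
  · rw [Hhat_one ha, h0, map_zero, sub_zero, constantCoeff_Hhat_Hhat_one ha hb]
  · rw [Hhat_one hb, h0, map_zero, zero_sub, constantCoeff_Hhat_Hhat_one hb ha, add_comm b a]
    split_ifs with hab
    · obtain rfl : b = -a - 1 := by omega
      push_cast
      ring
    · simp
  · rw [constantCoeff_Hhat ha, constantCoeff_Hhat hb, if_neg (by omega), sub_zero]

/-- **Twisted Heisenberg commutation relations:** the modes `h^t_m`, `m ∈ ℤ+1/2`, of the
twisted Heisenberg field constructed from the CKP field `χ(z)` satisfy
`[h^t_m, h^t_n] = −m δ_{m+n,0}·1`. -/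
theorem ckp_twisted_heisenberg_relations (a b : ℤ) (P : MvPolynomial ℕ ℂ) :
    Hhat a (Hhat b P) - Hhat b (Hhat a P)
      = (if a + b + 1 = 0 then -((a : ℂ) + 1/2) else 0) • P := by
  rw [← HhatBracket_apply, HhatBracket_eq_smul, constantCoeff_HhatBracket_one]
end

section
/- The operators L^t_0 and the charge operator Ĝ_0 do not commute: there exists P ∈ R with L^t_0(Ĝ_0 P) ≠ Ĝ_0(L^t_0 P). (Consequently the grading operators L^t_0 and h^ℤ_0 cannot be simultaneously diagonalized on the CKP Fock space F_χ.) -/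
open MvPolynomial

/-- The grading operator `L^t_0 = −∑_{n∈ℤ+1/2, n>0} h^t_{−n} h^t_n`, the zero mode of the
Virasoro field `L^χ(z)` shifted by `−1/16`. -/
noncomputable def Lt0 (P : MvPolynomial ℕ ℂ) : MvPolynomial ℕ ℂ :=
  -∑ᶠ a : ℕ, Hhat (-(a : ℤ) - 1) (Hhat (a : ℤ) P)

/-- The charge operator `Ĝ_0 = ∑_{c∈ℕ} (−1)^c X_c ∂_{X_c}`, realizing
`h^ℤ_0 = ∑_{k>0} :χ_{−k}χ_k:`. -/
noncomputable def G0 (P : MvPolynomial ℕ ℂ) : MvPolynomial ℕ ℂ :=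
  ∑ᶠ c : ℕ, (-1 : ℂ) ^ c • (X c * pderiv c P)

theorem chiHat_of_nonneg {m : ℤ} (hm : 0 ≤ m) (P : MvPolynomial ℕ ℂ) :
    chiHat m P = (-1 : ℂ) ^ m.toNat • pderiv m.toNat P := by
  simp [chiHat, hm]

theorem chiHat_of_neg {m : ℤ} (hm : m < 0) (P : MvPolynomial ℕ ℂ) :
    chiHat m P = X (-m - 1).toNat * P := by
  simp [chiHat, not_le.mpr hm]

theorem Hhat_smul (a : ℤ) (s : ℂ) (P : MvPolynomial ℕ ℂ) :
    Hhat a (s • P) = s • Hhat a P := by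
  simp only [Hhat, map_smul]
  rw [smul_comm s (1 / 2 : ℂ), smul_finsum s]
  exact congrArg _ (finsum_congr fun c => smul_comm _ _ _)

theorem Hhat_zero_right (a : ℤ) : Hhat a 0 = 0 := by
  simp [Hhat]

theorem Lt0_smul (s : ℂ) (P : MvPolynomial ℕ ℂ) : Lt0 (s • P) = s • Lt0 P := by
  simp only [Lt0, Hhat_smul, smul_neg, smul_finsum]

theorem Hhat_zero_X_one : Hhat 0 (X 1) = -X 0 := by
  have hsupp : ∀ c : ℤ, c ∉ ({1, -1} : Finset ℤ) →
      (-1 : ℂ) ^ (c + 1) • chiHat (2 * 0 - c) (chiHat c (X 1)) = 0 := by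
    intro c hc
    simp only [Finset.mem_insert, Finset.mem_singleton, not_or] at hc
    rcases le_or_gt 0 c with h | h
    · rw [chiHat_of_nonneg h, pderiv_X_of_ne (by omega)]
      simp
    · rw [chiHat_of_neg h, chiHat_of_nonneg (by omega), pderiv_mul,
        pderiv_X_of_ne (by omega), pderiv_X_of_ne (by omega)]
      simp
  rw [Hhat, finsum_eq_sum_of_support_subset (s := {1, -1}) _
    (Function.support_subset_iff'.mpr hsupp), Finset.sum_pair (by decide)]
  simp [chiHat]
  module

theorem Hhat_X_one_of_pos {a : ℤ} (ha : 0 < a) : Hhat a (X 1) = 0 := by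
  have hterm : ∀ c : ℤ, (-1 : ℂ) ^ (c + 1) • chiHat (2 * a - c) (chiHat c (X 1)) = 0 := by
    intro c
    rcases le_or_gt 0 c with h | h
    · by_cases h1 : c = 1
      · subst h1
        rw [chiHat_of_nonneg h, chiHat_of_nonneg (by omega)]
        simp
      · rw [chiHat_of_nonneg h, pderiv_X_of_ne (by omega)]
        simp
    · rw [chiHat_of_neg h, chiHat_of_nonneg (by omega), pderiv_mul,
        pderiv_X_of_ne (by omega), pderiv_X_of_ne (by omega)]
      simp
  simp only [Hhat, hterm, finsum_zero, smul_zero]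

theorem Hhat_neg_one_X_zero :
    Hhat (-1) (X 0) = (1 / 2 : ℂ) • X 0 ^ 3 - X 1 := by
  have hsupp : ∀ c : ℤ, c ∉ ({0, -1, -2} : Finset ℤ) →
      (-1 : ℂ) ^ (c + 1) • chiHat (2 * (-1) - c) (chiHat c (X 0)) = 0 := by
    intro c hc
    simp only [Finset.mem_insert, Finset.mem_singleton, not_or] at hc
    rcases le_or_gt 0 c with h | h
    · rw [chiHat_of_nonneg h, pderiv_X_of_ne (by omega)]
      simp
    · rw [chiHat_of_neg h, chiHat_of_nonneg (by omega), pderiv_mul,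
        pderiv_X_of_ne (by omega), pderiv_X_of_ne (by omega)]
      simp
  rw [Hhat, finsum_eq_sum_of_support_subset (s := {0, -1, -2}) _
    (Function.support_subset_iff'.mpr hsupp), Finset.sum_insert (by decide),
    Finset.sum_pair (by decide)]
  simp [chiHat]
  rw [show (X 0 * (X 0 * X 0) : MvPolynomial ℕ ℂ) = X 0 ^ 3 by ring]
  module

theorem Lt0_X_one : Lt0 (X 1) = (1 / 2 : ℂ) • X 0 ^ 3 - X 1 := by
  rw [Lt0, finsum_eq_single _ 0]
  · have h : (-X 0 : MvPolynomial ℕ ℂ) = (-1 : ℂ) • X 0 := by simp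
    simp only [Nat.cast_zero, neg_zero, zero_sub, Hhat_zero_X_one]
    rw [h, Hhat_smul, Hhat_neg_one_X_zero]
    module
  · intro a ha
    rw [Hhat_X_one_of_pos (by omega), Hhat_zero_right]

theorem G0_X_one : G0 (X 1) = (-1 : ℂ) • X 1 := by
  rw [G0, finsum_eq_single _ 1]
  · simp
  · intro c hc
    rw [pderiv_X_of_ne hc.symm]
    simp

theorem G0_Lt0_X_one : G0 (Lt0 (X 1)) = (3 / 2 : ℂ) • X 0 ^ 3 + X 1 := by
  have hsupp : ∀ c : ℕ, c ∉ ({0, 1} : Finset ℕ) →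
      (-1 : ℂ) ^ c • (X c * pderiv c ((1 / 2 : ℂ) • X 0 ^ 3 - X 1 : MvPolynomial ℕ ℂ)) = 0 := by
    intro c hc
    simp only [Finset.mem_insert, Finset.mem_singleton, not_or] at hc
    simp [pderiv_X_of_ne (Ne.symm hc.1), pderiv_X_of_ne (Ne.symm hc.2)]
  rw [Lt0_X_one, G0, finsum_eq_sum_of_support_subset (s := {0, 1}) _
    (Function.support_subset_iff'.mpr hsupp), Finset.sum_pair (by decide)]
  simp [smul_eq_C_mul]
  have h : (C (3 / 2) : MvPolynomial ℕ ℂ) = C 2⁻¹ * 3 := by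
    rw [← map_ofNat C 3, ← C_mul]
    norm_num
  rw [h]
  ring

/-- **The grading operators `L^t_0` and `h^ℤ_0` do not commute** on the CKP Fock space,
hence cannot be simultaneously diagonalized. -/
theorem ckp_Lt0_charge_do_not_commute :
    ∃ P : MvPolynomial ℕ ℂ, Lt0 (G0 P) ≠ G0 (Lt0 P) := by
  refine ⟨X 1, fun h => ?_⟩
  rw [G0_Lt0_X_one, G0_X_one, Lt0_smul, Lt0_X_one] at h
  have h' := congrArg (eval fun n : ℕ => if n = 0 then (1 : ℂ) else 0) h
  norm_num [smul_eval] at h'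
end

section
/- For every N ∈ ℕ, the number of pairs (m, μ), where m ∈ ℕ and μ is a partition into pairwise distinct odd positive integer parts such that m(m+1) + |μ| = N, equals the number of ordered pairs (π₁, π₂) of distinct partitions with W₂(π₁, π₂) = N. (This encodes, with all weights doubled to make them integers, the one-to-one correspondence between the set 𝔓_tdo of partitions consisting of one triangular part T_m = m(m+1)/2 together with pairwise distinct parts from ℤ_{≥0}+1/2, and the set 𝔅𝔓_DI of distinct integer bipartitions: the correspondence is not an isometry, and the 𝔓_tdo-weight of a partition equals half the value W₂ of the corresponding bipartition.) -/
/-- The doubled weight `W₂(π₁,π₂) = 4|π₁| + 4|π₂| + 4ns − n(2n−1) − s(2s+1)` of a distinct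
integer bipartition (a pair of finite sets of positive integers), where `n` and `s` are
the numbers of parts of `π₁` and `π₂`.  It is twice the weight `𝒲(π₁|π₂)` of the
corresponding highest weight vector of the untwisted Heisenberg action on the CKP Fock
space. -/
def W2 (p : Finset ℕ × Finset ℕ) : ℤ :=
  4 * (∑ x ∈ p.1, (x : ℤ)) + 4 * (∑ x ∈ p.2, (x : ℤ))
    + 4 * (p.1.card : ℤ) * (p.2.card : ℤ)
    - (p.1.card : ℤ) * (2 * (p.1.card : ℤ) - 1)
    - (p.2.card : ℤ) * (2 * (p.2.card : ℤ) + 1)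

/-- Shanks's finite form of Gauss's identity for triangular numbers, cleared of denominators. -/
theorem sum_pow_triangular_mul_prod {R : Type*} [CommRing R] (x : R) (n : ℕ) :
    (∑ m ∈ Finset.range n, x ^ (m * (2 * m + 1)) * (1 + x ^ (2 * m + 1))) *
        ∏ k ∈ Finset.range n, (1 - x ^ (2 * k + 1)) =
      ∑ s ∈ Finset.range n, (∏ k ∈ Finset.range s, (1 - x ^ (2 * k + 1))) *
        (∏ k ∈ Finset.Ico s n, (1 - x ^ (2 * k + 2))) * x ^ (s * (2 * n + 1)) := by
  induction n with
  | zero => simp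
  | succ n ih =>
    have telescope : ∀ m ≤ n, ∑ s ∈ Finset.range m,
        (∏ k ∈ Finset.range s, (1 - x ^ (2 * k + 1))) *
          (∏ k ∈ Finset.Ico s n, (1 - x ^ (2 * k + 2))) * x ^ (s * (2 * n + 1)) *
          ((1 - x ^ (2 * n + 2)) * x ^ (2 * s) - (1 - x ^ (2 * n + 1))) =
        (∏ k ∈ Finset.range m, (1 - x ^ (2 * k + 1))) * (1 - x ^ (2 * m)) *
          (∏ k ∈ Finset.Ico m n, (1 - x ^ (2 * k + 2))) * x ^ (m * (2 * n + 1)) := by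
      intro m hm
      induction m with
      | zero => simp
      | succ m ihm =>
        rw [Finset.sum_range_succ, ihm (by omega), Finset.prod_range_succ,
          Finset.prod_eq_prod_Ico_succ_bot (show m < n by omega)]
        ring
    have step : ∑ s ∈ Finset.range n, (∏ k ∈ Finset.range s, (1 - x ^ (2 * k + 1))) *
        (∏ k ∈ Finset.Ico s (n + 1), (1 - x ^ (2 * k + 2))) * x ^ (s * (2 * (n + 1) + 1)) =
        (1 - x ^ (2 * n + 1)) * (∑ s ∈ Finset.range n,
          (∏ k ∈ Finset.range s, (1 - x ^ (2 * k + 1))) *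
          (∏ k ∈ Finset.Ico s n, (1 - x ^ (2 * k + 2))) * x ^ (s * (2 * n + 1))) +
        (∏ k ∈ Finset.range n, (1 - x ^ (2 * k + 1))) * (1 - x ^ (2 * n)) *
          x ^ (n * (2 * n + 1)) := by
      have h := telescope n le_rfl
      simp only [Finset.Ico_self, Finset.prod_empty, mul_one] at h
      rw [← h, Finset.mul_sum, ← Finset.sum_add_distrib]
      refine Finset.sum_congr rfl fun s hs => ?_
      rw [Finset.prod_Ico_succ_top (Finset.mem_range.1 hs).le]
      ring
    rw [Finset.sum_range_succ _ n, Finset.sum_range_succ _ n, step, ← ih,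
      Finset.prod_range_succ, Finset.prod_Ico_succ_top le_rfl, Finset.Ico_self,
      Finset.prod_empty]
    ring

/-- Gauss's identity for triangular numbers, up to a power of the variable. -/
theorem pow_dvd_sum_pow_triangular_mul_prod_sub {R : Type*} [CommRing R] (x : R) {n : ℕ}
    (hn : 0 < n) :
    x ^ (2 * n + 1) ∣ (∑ m ∈ Finset.range (2 * n), x ^ (m * (m + 1) / 2)) *
        ∏ k ∈ Finset.range n, (1 - x ^ (2 * k + 1)) -
      ∏ k ∈ Finset.range n, (1 - x ^ (2 * k + 2)) := by
  have pairing : ∑ m ∈ Finset.range (2 * n), x ^ (m * (m + 1) / 2) =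
      ∑ m ∈ Finset.range n, x ^ (m * (2 * m + 1)) * (1 + x ^ (2 * m + 1)) := by
    clear hn
    induction n with
    | zero => simp
    | succ n ih =>
      rw [show 2 * (n + 1) = 2 * n + 1 + 1 by ring, Finset.sum_range_succ,
        Finset.sum_range_succ, ih, Finset.sum_range_succ,
        show 2 * n * (2 * n + 1) / 2 = n * (2 * n + 1) by
          rw [mul_assoc]; exact Nat.mul_div_cancel_left _ two_pos,
        show (2 * n + 1) * (2 * n + 1 + 1) / 2 = (n + 1) * (2 * n + 1) by
          rw [show (2 * n + 1) * (2 * n + 1 + 1) = 2 * ((n + 1) * (2 * n + 1)) by ring]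
          exact Nat.mul_div_cancel_left _ two_pos]
      ring
  rw [pairing, sum_pow_triangular_mul_prod]
  obtain ⟨n, rfl⟩ := Nat.exists_eq_add_one_of_ne_zero hn.ne'
  rw [Finset.sum_range_succ', Finset.range_zero, Finset.prod_empty, one_mul, zero_mul, pow_zero,
    mul_one, ← Finset.range_eq_Ico, add_sub_cancel_right]
  refine Finset.dvd_sum fun s _ => Dvd.dvd.mul_left (pow_dvd_pow _ ?_) _
  nlinarith

/-- Twice the sum of the differences between the increasingly sorted elements of `S` and their
ranks. -/
def doubledExcess (S : Finset ℕ) : ℤ :=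
  2 * (∑ x ∈ S, (x : ℤ)) - (S.card : ℤ) * ((S.card : ℤ) - 1)

theorem doubledExcess_bounds (S : Finset ℕ) :
    0 ≤ doubledExcess S ∧ ∀ x ∈ S, 2 * ((x : ℤ) + 1) ≤ doubledExcess S + 2 * S.card := by
  induction S using Finset.induction_on_max with
  | empty => simp [doubledExcess]
  | insert a S hlt ih =>
    have ha : a ∉ S := fun h => (hlt a h).false
    have hcard : (S.card : ℤ) ≤ a := by
      have := Finset.card_le_card (fun x hx => Finset.mem_range.2 (hlt x hx) : S ⊆ Finset.range a)
      rw [Finset.card_range] at this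
      exact_mod_cast this
    have hex : doubledExcess (insert a S) = doubledExcess S + 2 * (a - S.card) := by
      simp only [doubledExcess, Finset.sum_insert ha, Finset.card_insert_of_notMem ha]
      push_cast
      ring
    rw [hex, Finset.card_insert_of_notMem ha]
    push_cast
    refine ⟨by linarith [ih.1], fun x hx => ?_⟩
    rcases Finset.mem_insert.1 hx with rfl | hx
    · linarith [ih.1]
    · linarith [ih.2 x hx]

/-- The exponent in `∑ z ^ n * y ^ s * q ^ (4 * n * s) / ((q⁴; q⁴)ₙ (q⁴; q⁴)ₛ)` for `y = q ^ a`
and `z = q ^ b`, in terms of finite sets of `n` and `s` natural numbers. -/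
def pairWeight (a b : ℕ) (p : Finset ℕ × Finset ℕ) : ℤ :=
  2 * doubledExcess p.1 + 2 * doubledExcess p.2 + 4 * (p.1.card : ℤ) * (p.2.card : ℤ)
    + b * (p.1.card : ℤ) + a * (p.2.card : ℤ)

theorem pairWeight_swap (a b : ℕ) (p : Finset ℕ × Finset ℕ) :
    pairWeight a b p.swap = pairWeight b a p := by
  simp only [pairWeight, Prod.fst_swap, Prod.snd_swap]
  ring

theorem le_pairWeight (a b : ℕ) (p : Finset ℕ × Finset ℕ) :
    b * (p.1.card : ℤ) + a * (p.2.card : ℤ) ≤ pairWeight a b p := by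
  have h₁ := (doubledExcess_bounds p.1).1
  have h₂ := (doubledExcess_bounds p.2).1
  have h₃ : 0 ≤ 4 * (p.1.card : ℤ) * (p.2.card : ℤ) := by positivity
  unfold pairWeight
  linarith

theorem finite_pairWeight_eq {a b : ℕ} (ha : 0 < a) (hb : 0 < b) (N : ℤ) :
    {p | pairWeight a b p = N}.Finite := by
  refine (Finset.finite_toSet ((Finset.range N.toNat).powerset ×ˢ
    (Finset.range N.toNat).powerset)).subset fun p hp => ?_
  have hp : pairWeight a b p = N := hp
  have h₁ := doubledExcess_bounds p.1
  have h₂ := doubledExcess_bounds p.2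
  have h₃ : 0 ≤ 4 * (p.1.card : ℤ) * (p.2.card : ℤ) := by positivity
  have h₄ : (p.1.card : ℤ) ≤ b * p.1.card :=
    le_mul_of_one_le_left (by positivity) (by exact_mod_cast hb)
  have h₅ : (p.2.card : ℤ) ≤ a * p.2.card :=
    le_mul_of_one_le_left (by positivity) (by exact_mod_cast ha)
  unfold pairWeight at hp
  simp only [Finset.coe_product, Finset.coe_powerset, Set.mem_prod, Set.mem_preimage,
    Set.mem_powerset_iff, Finset.coe_subset]
  constructor <;> intro x hx <;> rw [Finset.mem_range]
  · have := h₁.2 x hx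
    omega
  · have := h₂.2 x hx
    omega

/-- The increment of all elements of a finite set of natural numbers. -/
def shiftUp (S : Finset ℕ) : Finset ℕ := S.map (addRightEmbedding 1)

theorem shiftUp_injective : Function.Injective shiftUp := Finset.map_injective _

theorem zero_notMem_shiftUp (S : Finset ℕ) : 0 ∉ shiftUp S := by simp [shiftUp]

theorem exists_shiftUp_eq {S : Finset ℕ} (h : 0 ∉ S) : ∃ T, shiftUp T = S := by
  refine ⟨S.image Nat.pred, ?_⟩
  ext x
  simp only [shiftUp, Finset.mem_map, Finset.mem_image, addRightEmbedding_apply,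
    exists_exists_and_eq_and]
  constructor
  · rintro ⟨y, hy, rfl⟩
    have : y ≠ 0 := fun h' => h (h' ▸ hy)
    rwa [Nat.pred_eq_sub_one, Nat.sub_add_cancel (by omega)]
  · intro hx
    have : x ≠ 0 := fun h' => h (h' ▸ hx)
    exact ⟨x, hx, by rw [Nat.pred_eq_sub_one]; omega⟩

theorem card_shiftUp (S : Finset ℕ) : (shiftUp S).card = S.card := Finset.card_map _

theorem sum_shiftUp (S : Finset ℕ) :
    ∑ x ∈ shiftUp S, (x : ℤ) = ∑ x ∈ S, (x : ℤ) + S.card := by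
  simp [shiftUp, Finset.sum_add_distrib]

theorem doubledExcess_shiftUp (S : Finset ℕ) :
    doubledExcess (shiftUp S) = doubledExcess S + 2 * S.card := by
  simp only [doubledExcess, card_shiftUp, sum_shiftUp]
  ring

theorem doubledExcess_insert_zero_shiftUp (S : Finset ℕ) :
    doubledExcess (insert 0 (shiftUp S)) = doubledExcess S := by
  simp only [doubledExcess, Finset.sum_insert (zero_notMem_shiftUp S),
    Finset.card_insert_of_notMem (zero_notMem_shiftUp S), card_shiftUp, sum_shiftUp]
  push_cast
  ring

theorem ncard_pairWeight_swap (a b : ℕ) (N : ℤ) :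
    {p | pairWeight a b p = N}.ncard = {p | pairWeight b a p = N}.ncard := by
  rw [← Set.ncard_image_of_injective {p | pairWeight b a p = N} Prod.swap_injective]
  congr 1
  ext p
  simp only [Set.image_swap_eq_preimage_swap, Set.mem_preimage, Set.mem_ofPred_eq, pairWeight_swap]

theorem ncard_pairWeight_rec {a b : ℕ} (ha : 0 < a) (hb : 0 < b) (N : ℤ) :
    {p | pairWeight a b p = N}.ncard =
      {p | pairWeight (a + 4) b p = N}.ncard + {p | pairWeight a (b + 4) p = N - a}.ncard := by
  let f : Finset ℕ × Finset ℕ → Finset ℕ × Finset ℕ := fun p => (p.1, shiftUp p.2)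
  let g : Finset ℕ × Finset ℕ → Finset ℕ × Finset ℕ := fun p => (p.1, insert 0 (shiftUp p.2))
  have hf : f.Injective := fun p q h =>
    Prod.ext (Prod.ext_iff.1 h).1 (shiftUp_injective (Prod.ext_iff.1 h).2)
  have hg : g.Injective := fun p q h => by
    refine Prod.ext (Prod.ext_iff.1 h).1 (shiftUp_injective ?_)
    rw [← Finset.erase_insert (zero_notMem_shiftUp p.2),
      ← Finset.erase_insert (zero_notMem_shiftUp q.2)]
    exact congrArg (Finset.erase · 0) (Prod.ext_iff.1 h).2
  have wf (p) : pairWeight a b (f p) = pairWeight (a + 4) b p := by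
    simp only [pairWeight, f, doubledExcess_shiftUp, card_shiftUp]
    push_cast
    ring
  have wg (p) : pairWeight a b (g p) = pairWeight a (b + 4) p + a := by
    simp only [pairWeight, g, doubledExcess_insert_zero_shiftUp,
      Finset.card_insert_of_notMem (zero_notMem_shiftUp p.2), card_shiftUp]
    push_cast
    ring
  rw [← Set.ncard_image_of_injective {p | pairWeight (a + 4) b p = N} hf,
    ← Set.ncard_image_of_injective {p | pairWeight a (b + 4) p = N - a} hg,
    ← Set.ncard_union_eq ?_ ((finite_pairWeight_eq (by omega) hb _).image _)
      ((finite_pairWeight_eq ha (by omega) _).image _)]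
  · congr 1
    ext p
    simp only [Set.mem_union, Set.mem_image, Set.mem_ofPred_eq]
    constructor
    · intro hp
      by_cases h0 : 0 ∈ p.2
      · obtain ⟨T, hT⟩ := exists_shiftUp_eq (Finset.notMem_erase 0 p.2)
        have hgp : g (p.1, T) = p := Prod.ext rfl (by simp [g, hT, Finset.insert_erase h0])
        exact .inr ⟨_, by rw [← hp, ← hgp, wg]; simp [g], hgp⟩
      · obtain ⟨T, hT⟩ := exists_shiftUp_eq h0
        have hfp : f (p.1, T) = p := Prod.ext rfl hT
        exact .inl ⟨_, by rw [← hp, ← hfp, wf], hfp⟩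
    · rintro (⟨q, hq, rfl⟩ | ⟨q, hq, rfl⟩)
      · rw [wf, hq]
      · rw [wg, hq]
        ring
  · rw [Set.disjoint_left]
    rintro _ ⟨p, _, rfl⟩ ⟨q, _, h⟩
    apply zero_notMem_shiftUp p.2
    rw [← show _ = shiftUp p.2 from (Prod.ext_iff.1 h).2]
    exact Finset.mem_insert_self _ _

open PowerSeries in
/-- The generating function of pairs of finite sets of natural numbers by `pairWeight a b`. -/
noncomputable def pairSeries (a b : ℕ) : ℤ⟦X⟧ :=
  PowerSeries.mk fun N => ({p | pairWeight a b p = N}.ncard : ℤ)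

theorem pairSeries_swap (a b : ℕ) : pairSeries a b = pairSeries b a := by
  ext N
  simp only [pairSeries, PowerSeries.coeff_mk, ncard_pairWeight_swap a b]

open PowerSeries in
theorem pairSeries_rec {a b : ℕ} (ha : 0 < a) (hb : 0 < b) :
    pairSeries a b = pairSeries (a + 4) b + X ^ a * pairSeries a (b + 4) := by
  ext N
  simp only [pairSeries, map_add, coeff_mk, coeff_X_pow_mul', ncard_pairWeight_rec ha hb,
    Nat.cast_add]
  congr 1
  split_ifs with h
  · rw [Nat.cast_sub h]
  · have : {p | pairWeight a (b + 4) p = (N : ℤ) - a} = ∅ := by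
      ext p
      have h₁ := le_pairWeight a (b + 4) p
      have h₂ : 0 ≤ ((b + 4 : ℕ) : ℤ) * (p.1.card : ℤ) + a * (p.2.card : ℤ) := by positivity
      simp only [Set.mem_ofPred_eq, Set.mem_empty_iff_false, iff_false]
      omega
    simp [this]

open PowerSeries in
theorem one_sub_mul_pairSeries {a b : ℕ} (ha : 0 < a) (hb : 0 < b) :
    (1 - X ^ a) * pairSeries a b = (1 - X ^ (a + b)) * pairSeries (a + 4) b := by
  have h₁ := pairSeries_rec ha hb
  have h₂ := pairSeries_rec hb ha
  rw [pairSeries_swap b a, pairSeries_swap (b + 4) a, pairSeries_swap b (a + 4)] at h₂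
  linear_combination h₁ - X ^ a * h₂

open PowerSeries in
theorem prod_one_sub_mul_pairSeries {a b : ℕ} (ha : 0 < a) (hb : 0 < b) (J : ℕ) :
    (∏ j ∈ Finset.range J, (1 - X ^ (a + 4 * j))) * pairSeries a b =
      (∏ j ∈ Finset.range J, (1 - X ^ (a + b + 4 * j))) * pairSeries (a + 4 * J) b := by
  induction J with
  | zero => simp
  | succ J ih =>
    have h := one_sub_mul_pairSeries (a := a + 4 * J) (by omega) hb
    rw [Finset.prod_range_succ, Finset.prod_range_succ, mul_right_comm, ih,
      show a + 4 * (J + 1) = a + 4 * J + 4 by ring, show a + b + 4 * J = a + 4 * J + b by ring]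
    linear_combination (∏ j ∈ Finset.range J, (1 - X ^ (a + b + 4 * j))) * h

open PowerSeries in
theorem X_pow_dvd_pairSeries_sub_one {a b K : ℕ} (ha : K ≤ a) (hb : K ≤ b) :
    X ^ K ∣ pairSeries a b - 1 := by
  rw [X_pow_dvd_iff]
  intro N hN
  have hset : {p | pairWeight a b p = (N : ℤ)} = if N = 0 then {(∅, ∅)} else ∅ := by
    have key (p) (hp : pairWeight a b p = N) : p = (∅, ∅) := by
      have h := le_pairWeight a b p
      rw [hp] at h
      norm_cast at h
      refine Prod.ext (Finset.card_eq_zero.1 ?_) (Finset.card_eq_zero.1 ?_) <;>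
        by_contra hne <;> have := Nat.pos_of_ne_zero hne <;> nlinarith
    have h0 : pairWeight a b (∅, ∅) = 0 := by simp [pairWeight, doubledExcess]
    ext p
    split_ifs with h
    · subst h
      exact ⟨key p, fun hp => by rw [Set.mem_singleton_iff.1 hp]; simpa using h0⟩
    · refine ⟨fun hp => h ?_, fun hp => hp.elim⟩
      have hp' : pairWeight a b p = N := hp
      rw [key p hp', h0] at hp'
      exact_mod_cast hp'.symm
  simp only [pairSeries, map_sub, coeff_mk, coeff_one, hset]
  split_ifs <;> simp

open PowerSeries in
theorem X_pow_dvd_prod_mul_pairSeries_sub (J : ℕ) :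
    X ^ (4 * J) ∣ (∏ k ∈ Finset.range (2 * J), (1 - X ^ (2 * k + 1))) * pairSeries 1 3 -
      ∏ k ∈ Finset.range (2 * J), (1 - X ^ (4 * k + 4)) := by
  have h₁ := prod_one_sub_mul_pairSeries (a := 1) (b := 3) one_pos three_pos J
  have h₂ := prod_one_sub_mul_pairSeries (a := 3) (b := 1 + 4 * J) three_pos (by omega) J
  rw [pairSeries_swap 3, pairSeries_swap (3 + 4 * J)] at h₂
  have hodd : ∏ k ∈ Finset.range (2 * J), (1 - (X : ℤ⟦X⟧) ^ (2 * k + 1)) =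
      (∏ j ∈ Finset.range J, (1 - X ^ (1 + 4 * j))) *
        ∏ j ∈ Finset.range J, (1 - X ^ (3 + 4 * j)) := by
    clear h₁ h₂
    induction J with
    | zero => simp
    | succ J ih =>
      rw [show 2 * (J + 1) = 2 * J + 1 + 1 by ring, Finset.prod_range_succ,
        Finset.prod_range_succ, ih, Finset.prod_range_succ, Finset.prod_range_succ]
      ring
  have heven : ∏ k ∈ Finset.range (2 * J), (1 - (X : ℤ⟦X⟧) ^ (4 * k + 4)) =
      (∏ j ∈ Finset.range J, (1 - X ^ (1 + 3 + 4 * j))) *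
        ∏ j ∈ Finset.range J, (1 - X ^ (3 + (1 + 4 * J) + 4 * j)) := by
    rw [two_mul, Finset.prod_range_add]
    congr 1 <;> refine Finset.prod_congr rfl fun j _ => ?_ <;> ring
  have h₃ : (∏ k ∈ Finset.range (2 * J), (1 - (X : ℤ⟦X⟧) ^ (2 * k + 1))) * pairSeries 1 3 -
      ∏ k ∈ Finset.range (2 * J), (1 - X ^ (4 * k + 4)) =
      (∏ k ∈ Finset.range (2 * J), (1 - X ^ (4 * k + 4))) *
        (pairSeries (1 + 4 * J) (3 + 4 * J) - 1) := by
    rw [hodd, heven]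
    linear_combination (∏ j ∈ Finset.range J, (1 - (X : ℤ⟦X⟧) ^ (3 + 4 * j))) * h₁ +
      (∏ j ∈ Finset.range J, (1 - (X : ℤ⟦X⟧) ^ (1 + 3 + 4 * j))) * h₂
  rw [h₃]
  exact Dvd.dvd.mul_left (X_pow_dvd_pairSeries_sub_one (by omega) (by omega)) _

open PowerSeries in
theorem X_pow_dvd_prod_mul_triangular_sub {M : ℕ} (hM : 0 < M) :
    X ^ (4 * M + 2) ∣ (∏ k ∈ Finset.range M, (1 - (X : ℤ⟦X⟧) ^ (2 * k + 1))) *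
        ((∑ m ∈ Finset.range (2 * M), X ^ (m * (m + 1))) *
          ∏ k ∈ Finset.range M, (1 + X ^ (2 * k + 1))) -
      ∏ k ∈ Finset.range M, (1 - X ^ (4 * k + 4)) := by
  have h := pow_dvd_sum_pow_triangular_mul_prod_sub ((X : ℤ⟦X⟧) ^ 2) hM
  simp only [← pow_mul] at h
  have hsum : ∑ m ∈ Finset.range (2 * M), (X : ℤ⟦X⟧) ^ (2 * (m * (m + 1) / 2)) =
      ∑ m ∈ Finset.range (2 * M), X ^ (m * (m + 1)) :=
    Finset.sum_congr rfl fun m _ => by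
      rw [Nat.mul_div_cancel' (Nat.even_mul_succ_self m).two_dvd]
  have hprod : ∏ k ∈ Finset.range M, (1 - (X : ℤ⟦X⟧) ^ (2 * (2 * k + 1))) =
      (∏ k ∈ Finset.range M, (1 - X ^ (2 * k + 1))) *
        ∏ k ∈ Finset.range M, (1 + X ^ (2 * k + 1)) := by
    rw [← Finset.prod_mul_distrib]
    exact Finset.prod_congr rfl fun k _ => by ring
  rw [hsum, hprod] at h
  convert h using 1
  · ring
  · rw [show ∏ k ∈ Finset.range M, (1 - (X : ℤ⟦X⟧) ^ (2 * (2 * k + 2))) =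
      ∏ k ∈ Finset.range M, (1 - X ^ (4 * k + 4)) from
        Finset.prod_congr rfl fun k _ => by ring]
    ring

open PowerSeries in
theorem coeff_triangular_mul_prod_eq_coeff_pairSeries {N J : ℕ} (h : N < J) :
    coeff N ((∑ m ∈ Finset.range (2 * (2 * J)), (X : ℤ⟦X⟧) ^ (m * (m + 1))) *
      ∏ k ∈ Finset.range (2 * J), (1 + X ^ (2 * k + 1))) = coeff N (pairSeries 1 3) := by
  have h₁ := X_pow_dvd_prod_mul_pairSeries_sub J
  have h₂ := (pow_dvd_pow (X : ℤ⟦X⟧) (show 4 * J ≤ 4 * (2 * J) + 2 by omega)).trans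
    (X_pow_dvd_prod_mul_triangular_sub (M := 2 * J) (by omega))
  have h₃ := dvd_sub h₂ h₁
  rw [sub_sub_sub_cancel_right, ← mul_sub] at h₃
  have hunit : IsUnit (∏ k ∈ Finset.range (2 * J), (1 - (X : ℤ⟦X⟧) ^ (2 * k + 1))) := by
    rw [isUnit_iff_constantCoeff]
    simp
  rw [hunit.dvd_mul_left, X_pow_dvd_iff] at h₃
  exact sub_eq_zero.1 (by simpa only [map_sub] using h₃ N (by omega))

theorem W2_shiftUp (p : Finset ℕ × Finset ℕ) :
    W2 (shiftUp p.1, shiftUp p.2) = pairWeight 1 3 p := by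
  simp only [W2, pairWeight, doubledExcess, card_shiftUp, sum_shiftUp]
  push_cast
  ring

theorem card_W2_eq (N : ℕ) :
    (Nat.card {p : Finset ℕ × Finset ℕ // 0 ∉ p.1 ∧ 0 ∉ p.2 ∧ W2 p = (N : ℤ)} : ℤ) =
      PowerSeries.coeff N (pairSeries 1 3) := by
  rw [pairSeries, PowerSeries.coeff_mk, ← Set.ncard_image_of_injective _
    (shiftUp_injective.prodMap shiftUp_injective), ← Nat.card_coe_set_eq]
  congr 2
  refine congrArg (fun s : Set (Finset ℕ × Finset ℕ) => (s : Type)) (Set.ext fun p => ?_)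
  simp only [Set.mem_image, Set.mem_ofPred_eq]
  constructor
  · rintro ⟨h₁, h₂, h⟩
    obtain ⟨S, hS⟩ := exists_shiftUp_eq h₁
    obtain ⟨T, hT⟩ := exists_shiftUp_eq h₂
    have hp : (shiftUp S, shiftUp T) = p := Prod.ext hS hT
    exact ⟨(S, T), by rw [← h, ← hp, ← W2_shiftUp], hp⟩
  · rintro ⟨q, hq, rfl⟩
    exact ⟨zero_notMem_shiftUp _, zero_notMem_shiftUp _, (W2_shiftUp q).trans hq⟩

open PowerSeries in
theorem card_triangular_odd_eq {N M : ℕ} (h : N < M) :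
    (Nat.card {p : ℕ × Finset ℕ //
        (∀ x ∈ p.2, Odd x ∧ 0 < x) ∧ p.1 * (p.1 + 1) + ∑ x ∈ p.2, x = N} : ℤ) =
      coeff N ((∑ m ∈ Finset.range (2 * M), (X : ℤ⟦X⟧) ^ (m * (m + 1))) *
        ∏ k ∈ Finset.range M, (1 + X ^ (2 * k + 1))) := by
  let odd : ℕ ↪ ℕ := ⟨fun k => 2 * k + 1, fun i j hij => by simpa using hij⟩
  have hprod : ∏ k ∈ Finset.range M, (1 + (X : ℤ⟦X⟧) ^ (2 * k + 1)) =
      ∑ t ∈ ((Finset.range M).map odd).powerset, X ^ (∑ x ∈ t, x) := by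
    rw [show ∏ k ∈ Finset.range M, (1 + (X : ℤ⟦X⟧) ^ (2 * k + 1)) =
      ∏ x ∈ (Finset.range M).map odd, (1 + X ^ x) from
        (Finset.prod_map (Finset.range M) odd fun x => 1 + (X : ℤ⟦X⟧) ^ x).symm,
      Finset.prod_one_add]
    exact Finset.sum_congr rfl fun t _ => Finset.prod_pow_eq_pow_sum t (fun x => x) X
  rw [hprod, Finset.sum_mul_sum, ← Finset.sum_product', map_sum]
  simp only [← pow_add, coeff_X_pow]
  rw [Finset.sum_boole, Nat.cast_inj, Nat.subtype_card]
  rintro ⟨m, t⟩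
  simp only [Finset.mem_filter, Finset.mem_product, Finset.mem_range, Finset.mem_powerset]
  constructor
  · rintro ⟨⟨-, ht⟩, hN⟩
    refine ⟨fun x hx => ?_, hN.symm⟩
    obtain ⟨k, -, rfl⟩ := Finset.mem_map.1 (ht hx)
    exact ⟨⟨k, rfl⟩, Nat.succ_pos _⟩
  · rintro ⟨ht, hN⟩
    have hm := Nat.le_mul_of_pos_right m (Nat.add_one_pos m)
    refine ⟨⟨by omega, fun x hx => ?_⟩, hN.symm⟩
    obtain ⟨k, rfl⟩ := (ht x hx).1
    have := Finset.single_le_sum (f := fun x => x) (fun _ _ => Nat.zero_le _) hx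
    exact Finset.mem_map.2 ⟨k, Finset.mem_range.2 (by omega), rfl⟩

/-- **The bijective (non-isometric) correspondence `𝔓_tdo ↔ 𝔅𝔓_DI`:** for every `N`, the
number of pairs `(m, μ)` of a natural number `m` and a partition `μ` into pairwise
distinct odd positive parts with `m(m+1) + |μ| = N` equals the number of ordered pairs
`(π₁, π₂)` of distinct partitions with doubled weight `W₂(π₁, π₂) = N`. -/
theorem ckp_tdo_bipartition_correspondence (N : ℕ) :
    Nat.card {p : ℕ × Finset ℕ //
        (∀ x ∈ p.2, Odd x ∧ 0 < x) ∧ p.1 * (p.1 + 1) + ∑ x ∈ p.2, x = N}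
      = Nat.card {p : Finset ℕ × Finset ℕ //
          0 ∉ p.1 ∧ 0 ∉ p.2 ∧ W2 p = (N : ℤ)} := by
  have h := card_triangular_odd_eq (N := N) (M := 2 * (N + 1)) (by omega)
  rw [coeff_triangular_mul_prod_eq_coeff_pairSeries N.lt_succ_self, ← card_W2_eq] at h
  exact_mod_cast h
end

section
/- Let D ∈ ℕ and m ∈ ℤ be such that D − m = 4t for some t ∈ ℕ. Then the number of ordered pairs (π₁, π₂) of distinct partitions with W₂(π₁,π₂) = D and birank(π₁,π₂) = m equals, as an integer, ∑_{l ∈ ℕ} N'(m − l, t) (a sum with only finitely many nonzero terms). (Equivalently, via the indexing of highest weight vectors by distinct integer bipartitions: the number of highest weight vectors of the untwisted Heisenberg action on the CKP Fock space having degree D/2 and charge m equals ∑_{l≥0} N'(m−l, (D−m)/4).) -/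
/-- The Hammond–Lewis birank `s − n` of a distinct integer bipartition. -/
def birank (p : Finset ℕ × Finset ℕ) : ℤ := (p.2.card : ℤ) - (p.1.card : ℤ)

/-- The Dyson crank of a partition `λ`: letting `ω(λ)` be the number of parts equal to
`1`, `l(λ)` the largest part and `μ(λ)` the number of parts strictly greater than `ω(λ)`,
the crank is `l(λ)` if `ω(λ) = 0` and `μ(λ) − ω(λ)` otherwise. -/
def crank {n : ℕ} (lam : Nat.Partition n) : ℤ :=
  if lam.parts.count 1 = 0 then (lam.parts.sup : ℤ)
  else ((lam.parts.filter (fun x => lam.parts.count 1 < x)).card : ℤ)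
    - (lam.parts.count 1 : ℤ)

/-- The Dyson crank counting function `N'(m,n)`: for `n ≠ 1` it is the number of
partitions of `n` with crank `m` (in particular `N'(0,0) = 1`), with the exceptional
values `N'(1,1) = N'(−1,1) = 1`, `N'(0,1) = −1`, `N'(m,1) = 0` for `|m| ≥ 2`. -/
noncomputable def Ncrank (m : ℤ) (n : ℕ) : ℤ :=
  if n = 1 then (if m = 1 ∨ m = -1 then 1 else if m = 0 then -1 else 0)
  else (Nat.card {lam : Nat.Partition n // crank lam = m} : ℤ)

namespace CrankCount

open PowerSeries

/-- The set `S` has finitely many elements of each weight. -/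
def FiniteFibres {α : Type*} (f : α → ℕ) (S : Set α) : Prop :=
  ∀ n, (S ∩ f ⁻¹' {n}).Finite

/-- The generating function counting the elements of `S` by their weight `f`. -/
noncomputable def weightGF {α : Type*} (f : α → ℕ) (S : Set α) : ℤ⟦X⟧ :=
  PowerSeries.mk fun n => ((S ∩ f ⁻¹' {n}).ncard : ℤ)

section WeightGF

variable {α β : Type*} {f : α → ℕ}

lemma coeff_weightGF (S : Set α) (n : ℕ) :
    coeff n (weightGF f S) = ((S ∩ f ⁻¹' {n}).ncard : ℤ) := by
  simp [weightGF]

lemma FiniteFibres.mono {S T : Set α} (hT : FiniteFibres f T) (h : S ⊆ T) :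
    FiniteFibres f S :=
  fun n => (hT n).subset (Set.inter_subset_inter_left _ h)

lemma weightGF_union {S T : Set α} (hS : FiniteFibres f S) (hT : FiniteFibres f T)
    (h : Disjoint S T) : weightGF f (S ∪ T) = weightGF f S + weightGF f T := by
  ext n
  rw [map_add, coeff_weightGF, coeff_weightGF, coeff_weightGF, Set.union_inter_distrib_right,
    Set.ncard_union_eq _ (hS n) (hT n)]
  · push_cast; rfl
  · exact h.mono Set.inter_subset_left Set.inter_subset_left

lemma weightGF_image {g : β → α} {f' : β → ℕ} {S : Set β} (k : ℕ) (hg : S.InjOn g)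
    (hk : ∀ b ∈ S, f (g b) = f' b + k) : weightGF f (g '' S) = X ^ k * weightGF f' S := by
  ext n
  rw [coeff_X_pow_mul', coeff_weightGF]
  split_ifs with h
  · rw [coeff_weightGF]
    have : g '' S ∩ f ⁻¹' {n} = g '' (S ∩ f' ⁻¹' {n - k}) := by
      ext x
      simp only [Set.mem_inter_iff, Set.mem_image, Set.mem_preimage, Set.mem_singleton_iff]
      constructor
      · rintro ⟨⟨b, hb, rfl⟩, hn⟩
        exact ⟨b, ⟨hb, by rw [hk b hb] at hn; omega⟩, rfl⟩
      · rintro ⟨b, ⟨hb, hn⟩, rfl⟩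
        exact ⟨⟨b, hb, rfl⟩, by rw [hk b hb]; omega⟩
    rw [this, (hg.mono Set.inter_subset_left).ncard_image]
  · have : g '' S ∩ f ⁻¹' {n} = ∅ := by
      ext x
      simp only [Set.mem_inter_iff, Set.mem_image, Set.mem_preimage, Set.mem_singleton_iff,
        Set.mem_empty_iff_false, iff_false]
      rintro ⟨⟨b, hb, rfl⟩, hn⟩
      rw [hk b hb] at hn; omega
    simp [this]

lemma weightGF_singleton {a : α} (h : f a = 0) : weightGF f {a} = 1 := by
  ext n
  rw [coeff_weightGF, coeff_one]
  split_ifs with hn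
  · have : ({a} : Set α) ∩ f ⁻¹' {n} = {a} := by
      ext x; simp only [Set.mem_inter_iff, Set.mem_singleton_iff, Set.mem_preimage]
      constructor
      · exact fun h => h.1
      · rintro rfl; exact ⟨rfl, by omega⟩
    simp [this]
  · have : ({a} : Set α) ∩ f ⁻¹' {n} = ∅ := by
      ext x; simp only [Set.mem_inter_iff, Set.mem_singleton_iff, Set.mem_preimage,
        Set.mem_empty_iff_false, iff_false]
      rintro ⟨rfl, h'⟩; omega
    simp [this]

lemma weightGF_prod {f' : β → ℕ} {S : Set α} {T : Set β} (hS : FiniteFibres f S)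
    (hT : FiniteFibres f' T) :
    weightGF (fun p : α × β => f p.1 + f' p.2) (S ×ˢ T) = weightGF f S * weightGF f' T := by
  classical
  ext n
  rw [coeff_mul, coeff_weightGF]
  have : (S ×ˢ T) ∩ (fun p : α × β => f p.1 + f' p.2) ⁻¹' {n} =
      ↑((Finset.HasAntidiagonal.antidiagonal n).biUnion fun i => (hS i.1).toFinset ×ˢ (hT i.2).toFinset) := by
    ext ⟨a, b⟩
    simp only [Set.mem_inter_iff, Set.mem_prod, Set.mem_preimage, Set.mem_singleton_iff,
      Finset.coe_biUnion, Finset.mem_coe, Finset.HasAntidiagonal.mem_antidiagonal, Finset.coe_product,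
      Set.Finite.coe_toFinset, Set.mem_iUnion, exists_prop, Prod.exists]
    constructor
    · rintro ⟨⟨ha, hb⟩, h⟩
      exact ⟨f a, f' b, h, ⟨ha, rfl⟩, hb, rfl⟩
    · rintro ⟨i, j, h, ⟨ha, rfl⟩, hb, rfl⟩
      exact ⟨⟨ha, hb⟩, h⟩
  rw [this, Set.ncard_coe_finset, Finset.card_biUnion]
  · push_cast
    refine Finset.sum_congr rfl fun i _ => ?_
    rw [Finset.card_product, coeff_weightGF, coeff_weightGF, Set.ncard_eq_toFinset_card _ (hS _),
      Set.ncard_eq_toFinset_card _ (hT _)]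
    push_cast; rfl
  · intro i _ j _ hij
    refine Finset.disjoint_left.2 ?_
    rintro ⟨a, b⟩ h1 h2
    simp only [Finset.mem_product, Set.Finite.mem_toFinset, Set.mem_inter_iff, Set.mem_preimage,
      Set.mem_singleton_iff] at h1 h2
    exact hij (Prod.ext (h1.1.2.symm.trans h2.1.2) (h1.2.2.symm.trans h2.2.2))

end WeightGF

/-- The inverse `1 / ((1 - X) (1 - X ^ 2) ⋯ (1 - X ^ k))` of the finite `q`-factorial. -/
noncomputable def invQFactorial : ℕ → ℤ⟦X⟧
  | 0 => 1
  | k + 1 => invQFactorial k * PowerSeries.invOfUnit (1 - X ^ (k + 1)) 1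

lemma one_sub_X_pow_mul_invQFactorial (k : ℕ) :
    (1 - X ^ (k + 1)) * invQFactorial (k + 1) = invQFactorial k := by
  rw [invQFactorial, mul_left_comm, PowerSeries.mul_invOfUnit, mul_one]
  simp

lemma one_sub_X_pow_ne_zero (k : ℕ) : (1 - X ^ (k + 1) : ℤ⟦X⟧) ≠ 0 := by
  intro h
  have := congrArg (constantCoeff (R := ℤ)) h
  simp at this

lemma constantCoeff_invQFactorial (k : ℕ) : constantCoeff (invQFactorial k) = 1 := by
  induction k with
  | zero => simp [invQFactorial]
  | succ k ih => simp [invQFactorial, ih]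

lemma finiteFibres_multiset : FiniteFibres Multiset.sum {s : Multiset ℕ | 0 ∉ s} := by
  intro n
  refine (Set.finite_range (fun p : Nat.Partition n => p.parts)).subset ?_
  rintro s ⟨h0, hs⟩
  exact ⟨⟨s, fun {i} hi => Nat.pos_of_ne_zero fun h => h0 (h ▸ hi), hs⟩, rfl⟩

/-- Multisets with exactly `j` parts, all of them at least `a`. -/
def partsGE (j a : ℕ) : Set (Multiset ℕ) := {s | s.card = j ∧ ∀ x ∈ s, a ≤ x}

lemma finiteFibres_partsGE (j a : ℕ) : FiniteFibres Multiset.sum (partsGE j (a + 1)) :=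
  finiteFibres_multiset.mono fun s hs h0 => by have := hs.2 0 h0; omega

lemma partsGE_succ (j a : ℕ) : partsGE (j + 1) a =
    (fun s => a ::ₘ s) '' partsGE j a ∪ partsGE (j + 1) (a + 1) := by
  ext s
  simp only [partsGE, Set.mem_union, Set.mem_image, Set.mem_ofPred_eq]
  constructor
  · rintro ⟨hc, hs⟩
    by_cases ha : a ∈ s
    · obtain ⟨r, rfl⟩ := Multiset.exists_cons_of_mem ha
      refine Or.inl ⟨r, ⟨by simpa using hc, fun x hx => hs x (by simp [hx])⟩, rfl⟩
    · refine Or.inr ⟨hc, fun x hx => ?_⟩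
      have := hs x hx
      have : x ≠ a := fun h => ha (h ▸ hx)
      omega
  · rintro (⟨r, ⟨hc, hr⟩, rfl⟩ | ⟨hc, hs⟩)
    · refine ⟨by simp [hc], fun x hx => ?_⟩
      rcases Multiset.mem_cons.1 hx with rfl | hx
      · exact le_rfl
      · exact hr x hx
    · exact ⟨hc, fun x hx => by have := hs x hx; omega⟩

lemma partsGE_shift (j a : ℕ) : partsGE j (a + 1) = Multiset.map Nat.succ '' partsGE j a := by
  ext s
  simp only [partsGE, Set.mem_image, Set.mem_ofPred_eq]
  constructor
  · rintro ⟨hc, hs⟩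
    refine ⟨s.map Nat.pred, ⟨by simpa using hc, fun x hx => ?_⟩, ?_⟩
    · obtain ⟨y, hy, rfl⟩ := Multiset.mem_map.1 hx
      have := hs y hy
      exact Nat.le_pred_of_lt this
    · rw [Multiset.map_map]
      conv_rhs => rw [← Multiset.map_id s]
      refine Multiset.map_congr rfl fun x hx => ?_
      have := hs x hx
      exact Nat.succ_pred_eq_of_pos (by omega)
  · rintro ⟨r, ⟨hc, hr⟩, rfl⟩
    refine ⟨by simpa using hc, fun x hx => ?_⟩
    obtain ⟨y, hy, rfl⟩ := Multiset.mem_map.1 hx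
    exact Nat.succ_le_succ (hr y hy)

lemma weightGF_partsGE (j a : ℕ) :
    weightGF Multiset.sum (partsGE j (a + 1)) = X ^ (j * (a + 1)) * invQFactorial j := by
  induction j with
  | zero =>
    have : partsGE 0 (a + 1) = {0} := by
      ext s
      simp only [partsGE, Set.mem_ofPred_eq, Multiset.card_eq_zero, Set.mem_singleton_iff]
      exact ⟨fun h => h.1, by rintro rfl; simp⟩
    rw [this, weightGF_singleton (by simp)]
    simp [invQFactorial]
  | succ j ih =>
    have h1 := congrArg (weightGF Multiset.sum) (partsGE_succ j (a + 1))
    rw [weightGF_union ((finiteFibres_partsGE (j + 1) a).mono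
        (by rw [partsGE_succ j (a + 1)]; exact Set.subset_union_left))
      (finiteFibres_partsGE (j + 1) (a + 1)) ?_,
      weightGF_image (f' := Multiset.sum) (a + 1) (fun s _ t _ h => by simpa using h)
        (fun s _ => by simp [add_comm]),
      partsGE_shift (j + 1) (a + 1),
      weightGF_image (f' := Multiset.sum) (j + 1) (Multiset.map_injective Nat.succ_injective).injOn
        ?_, ih] at h1
    · apply mul_left_cancel₀ (one_sub_X_pow_ne_zero j)
      rw [mul_left_comm, one_sub_X_pow_mul_invQFactorial]
      linear_combination h1
    · rintro s ⟨hc, -⟩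
      have : s.map Nat.succ = s.map (fun x => id x + 1) := rfl
      rw [this, Multiset.sum_map_add]
      simp [hc, add_comm]
    · rw [Set.disjoint_left]
      rintro s ⟨r, -, rfl⟩ ⟨-, hs⟩
      have := hs (a + 1) (by simp)
      omega

/-- Removing all parts `a` from a family stable under adding and removing a part `a`. -/
lemma weightGF_notMem {S : Set (Multiset ℕ)} (hS : FiniteFibres Multiset.sum S) (a : ℕ)
    (h : ∀ s, a ::ₘ s ∈ S ↔ s ∈ S) :
    weightGF Multiset.sum {s ∈ S | a ∉ s} = (1 - X ^ a) * weightGF Multiset.sum S := by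
  have hu : S = (fun s => a ::ₘ s) '' S ∪ {s ∈ S | a ∉ s} := by
    ext s
    simp only [Set.mem_union, Set.mem_image, Set.mem_ofPred_eq]
    constructor
    · intro hs
      by_cases ha : a ∈ s
      · obtain ⟨r, rfl⟩ := Multiset.exists_cons_of_mem ha
        exact Or.inl ⟨r, (h r).1 hs, rfl⟩
      · exact Or.inr ⟨hs, ha⟩
    · rintro (⟨r, hr, rfl⟩ | ⟨hs, -⟩)
      · exact (h r).2 hr
      · exact hs
  have h1 := congrArg (weightGF Multiset.sum) hu
  rw [weightGF_union (hS.mono (Set.subset_union_left.trans hu.symm.subset)) (hS.mono (Set.sep_subset _ _)) ?_,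
    weightGF_image (f' := Multiset.sum) a (fun s _ t _ h => by simpa using h)
        (fun s _ => by simp [add_comm])] at h1
  · linear_combination -h1
  · rw [Set.disjoint_left]
    rintro s ⟨r, -, rfl⟩ ⟨-, hs⟩
    simp at hs

/-- Multisets of positive parts, each at most `k` or greater than `w`, with exactly `j` parts
greater than `w`. -/
def splitParts (k w j : ℕ) : Set (Multiset ℕ) :=
  {s | 0 ∉ s ∧ (∀ x ∈ s, x ≤ k ∨ w < x) ∧ (s.filter (fun x => w < x)).card = j}

lemma cons_mem_splitParts {k w j a : ℕ} (h0 : 0 < a) (hk : a ≤ k) (hw : a ≤ w)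
    (s : Multiset ℕ) : a ::ₘ s ∈ splitParts k w j ↔ s ∈ splitParts k w j := by
  have : ¬ w < a := by omega
  simp [splitParts, this, hk, h0.ne]

lemma finiteFibres_splitParts (k w j : ℕ) : FiniteFibres Multiset.sum (splitParts k w j) :=
  finiteFibres_multiset.mono fun _ hs => hs.1

lemma weightGF_splitParts {k w : ℕ} (j : ℕ) (hk : k ≤ w) :
    weightGF Multiset.sum (splitParts k w j) =
      X ^ (j * (w + 1)) * (invQFactorial k * invQFactorial j) := by
  induction k with
  | zero =>
    have : splitParts 0 w j = partsGE j (w + 1) := by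
      ext s
      simp only [splitParts, partsGE, Set.mem_ofPred_eq]
      constructor
      · rintro ⟨h0, hs, hc⟩
        have hs' : ∀ x ∈ s, w < x := fun x hx => (hs x hx).resolve_left fun h =>
          h0 (by rwa [Nat.le_zero.1 h] at hx)
        rw [Multiset.filter_eq_self.2 hs'] at hc
        exact ⟨hc, hs'⟩
      · rintro ⟨hc, hs⟩
        have hs' : ∀ x ∈ s, w < x := hs
        refine ⟨fun h => by have := hs 0 h; omega, fun x hx => Or.inr (hs x hx), ?_⟩
        rwa [Multiset.filter_eq_self.2 hs']
    rw [this, weightGF_partsGE, invQFactorial, one_mul]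
  | succ k ih =>
    have h1 := weightGF_notMem (finiteFibres_splitParts (k + 1) w j) (k + 1)
      (cons_mem_splitParts (by omega) le_rfl hk)
    have : {s ∈ splitParts (k + 1) w j | k + 1 ∉ s} = splitParts k w j := by
      ext s
      simp only [splitParts, Set.mem_ofPred_eq]
      constructor
      · rintro ⟨⟨h0, hs, hc⟩, hn⟩
        refine ⟨h0, fun x hx => ?_, hc⟩
        have h2 := hs x hx
        have : x ≠ k + 1 := fun h => hn (h ▸ hx)
        omega
      · rintro ⟨h0, hs, hc⟩
        refine ⟨⟨h0, fun x hx => ?_, hc⟩, fun hn => ?_⟩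
        · have := hs x hx; omega
        · have := hs _ hn; omega
    rw [this, ih (by omega)] at h1
    apply mul_left_cancel₀ (one_sub_X_pow_ne_zero k)
    rw [← h1, ← one_sub_X_pow_mul_invQFactorial k]
    ring

lemma weightGF_splitParts_one_notMem (w j : ℕ) :
    weightGF Multiset.sum {s ∈ splitParts (w + 1) (w + 1) j | 1 ∉ s} =
      (1 - X) * (X ^ (j * (w + 2)) * (invQFactorial (w + 1) * invQFactorial j)) := by
  rw [weightGF_notMem (finiteFibres_splitParts _ _ j) 1
    (cons_mem_splitParts (by omega) (by omega) (by omega)), weightGF_splitParts j le_rfl, pow_one]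

lemma weightGF_count_one (w j : ℕ) :
    weightGF Multiset.sum {s : Multiset ℕ | 0 ∉ s ∧ s.count 1 = w + 1 ∧
        (s.filter (fun x => w + 1 < x)).card = j} =
      X ^ (w + 1 + j * (w + 2)) * (1 - X) * (invQFactorial (w + 1) * invQFactorial j) := by
  have : {s : Multiset ℕ | 0 ∉ s ∧ s.count 1 = w + 1 ∧
        (s.filter (fun x => w + 1 < x)).card = j} =
      (fun s => Multiset.replicate (w + 1) 1 + s) ''
        {s ∈ splitParts (w + 1) (w + 1) j | 1 ∉ s} := by
    have hr : (Multiset.replicate (w + 1) 1).filter (fun x => w + 1 < x) = 0 := by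
      rw [Multiset.filter_eq_nil]
      intro x hx
      rw [Multiset.eq_of_mem_replicate hx]; omega
    ext s
    simp only [splitParts, Set.mem_image, Set.mem_ofPred_eq]
    constructor
    · rintro ⟨h0, h1, hc⟩
      obtain ⟨r, rfl⟩ := Multiset.le_iff_exists_add.1 (Multiset.le_count_iff_replicate_le.1 h1.ge)
      refine ⟨r, ⟨⟨?_, fun x _ => le_or_gt x (w + 1), ?_⟩, ?_⟩, rfl⟩
      · exact fun h => h0 (by simp [h])
      · rwa [Multiset.filter_add, hr, zero_add] at hc
      · rw [Multiset.count_add, Multiset.count_replicate_self] at h1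
        exact Multiset.count_eq_zero.1 (by omega)
    · rintro ⟨r, ⟨⟨h0, -, hc⟩, h1⟩, rfl⟩
      refine ⟨?_, ?_, ?_⟩
      · simpa [Multiset.mem_replicate] using h0
      · rw [Multiset.count_add, Multiset.count_replicate_self, Multiset.count_eq_zero.2 h1]
      · rwa [Multiset.filter_add, hr, zero_add]
  rw [this, weightGF_image (f' := Multiset.sum) (w + 1) (add_right_injective _).injOn
    (fun s _ => by rw [Multiset.sum_add, Multiset.sum_replicate, smul_eq_mul, mul_one, add_comm]), weightGF_splitParts_one_notMem]
  ring

lemma weightGF_sup (w : ℕ) :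
    weightGF Multiset.sum {s : Multiset ℕ | 0 ∉ s ∧ s.count 1 = 0 ∧ s.sup = w + 2} =
      X ^ (w + 2) * (1 - X) * invQFactorial (w + 2) := by
  have : {s : Multiset ℕ | 0 ∉ s ∧ s.count 1 = 0 ∧ s.sup = w + 2} =
      (fun s => (w + 2) ::ₘ s) '' {s ∈ splitParts (w + 2) (w + 2) 0 | 1 ∉ s} := by
    ext s
    simp only [splitParts, Set.mem_image, Set.mem_ofPred_eq, Multiset.count_eq_zero,
      Multiset.card_eq_zero, Multiset.filter_eq_nil]
    constructor
    · rintro ⟨h0, h1, hs⟩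
      have hle : ∀ x ∈ s, x ≤ w + 2 := fun x hx => hs ▸ Multiset.le_sup hx
      have hm : w + 2 ∈ s := by
        by_contra hm
        have : s.sup ≤ w + 1 := Multiset.sup_le.2 fun x hx => by
          have := hle x hx
          have : x ≠ w + 2 := fun h => hm (h ▸ hx)
          omega
        omega
      obtain ⟨r, rfl⟩ := Multiset.exists_cons_of_mem hm
      simp only [Multiset.mem_cons, not_or, forall_eq_or_imp] at h0 h1 hle
      exact ⟨r, ⟨⟨h0.2, fun x hx => Or.inl (hle.2 x hx), fun x hx => by
        have := hle.2 x hx; omega⟩, h1.2⟩, rfl⟩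
    · rintro ⟨r, ⟨⟨h0, -, hc⟩, h1⟩, rfl⟩
      refine ⟨by simpa using h0, by simpa using h1, ?_⟩
      rw [Multiset.sup_cons]
      exact sup_eq_left.2 (Multiset.sup_le.2 fun x hx => not_lt.1 (hc x hx))
  rw [this, weightGF_image (f' := Multiset.sum) (w + 2) (fun s _ t _ h => by simpa using h)
    (fun s _ => by simp [add_comm]), weightGF_splitParts_one_notMem]
  simp [invQFactorial]
  ring

/-- Finite sets of `j` natural numbers, all of them at least `a`. -/
def distinctGE (j a : ℕ) : Set (Finset ℕ) := {s | s.card = j ∧ ∀ x ∈ s, a ≤ x}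

lemma finiteFibres_distinctGE (j a : ℕ) :
    FiniteFibres (fun s : Finset ℕ => ∑ x ∈ s, x) (distinctGE j a) := by
  intro n
  refine ((Finset.range (n + 1)).powerset.finite_toSet).subset ?_
  rintro s ⟨-, hs⟩
  simp only [Set.mem_preimage, Set.mem_singleton_iff] at hs
  rw [Finset.mem_coe, Finset.mem_powerset]
  intro x hx
  have : x ≤ ∑ y ∈ s, y := Finset.single_le_sum (f := fun x => x) (fun _ _ => Nat.zero_le _) hx
  rw [Finset.mem_range]
  omega

lemma distinctGE_succ (j a : ℕ) : distinctGE (j + 1) a =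
    (fun s => insert a s) '' distinctGE j (a + 1) ∪ distinctGE (j + 1) (a + 1) := by
  ext s
  simp only [distinctGE, Set.mem_union, Set.mem_image, Set.mem_ofPred_eq]
  constructor
  · rintro ⟨hc, hs⟩
    have hlt : ∀ x ∈ s, x ≠ a → a + 1 ≤ x := fun x hx h => by have := hs x hx; omega
    by_cases ha : a ∈ s
    · refine Or.inl ⟨s.erase a, ⟨by rw [Finset.card_erase_of_mem ha]; omega, fun x hx => ?_⟩,
        Finset.insert_erase ha⟩
      exact hlt x (Finset.mem_of_mem_erase hx) (Finset.ne_of_mem_erase hx)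
    · exact Or.inr ⟨hc, fun x hx => hlt x hx fun h => ha (h ▸ hx)⟩
  · rintro (⟨r, ⟨hc, hr⟩, rfl⟩ | ⟨hc, hs⟩)
    · refine ⟨?_, fun x hx => ?_⟩
      · rw [Finset.card_insert_of_notMem fun h => by have := hr a h; omega, hc]
      · rcases Finset.mem_insert.1 hx with rfl | hx
        · exact le_rfl
        · have := hr x hx; omega
    · exact ⟨hc, fun x hx => by have := hs x hx; omega⟩

lemma distinctGE_shift (j a : ℕ) :
    distinctGE j (a + 1) = Finset.map (addRightEmbedding 1) '' distinctGE j a := by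
  ext s
  simp only [distinctGE, Set.mem_image, Set.mem_ofPred_eq]
  constructor
  · rintro ⟨hc, hs⟩
    have hmap : (s.image Nat.pred).map (addRightEmbedding 1) = s := by
      ext x
      simp only [Finset.mem_map, Finset.mem_image, addRightEmbedding_apply]
      constructor
      · rintro ⟨_, ⟨y, hy, rfl⟩, rfl⟩
        have := hs y hy
        rwa [Nat.pred_eq_sub_one, Nat.sub_add_cancel (by omega)]
      · intro hx
        have := hs x hx
        exact ⟨_, ⟨x, hx, rfl⟩, Nat.succ_pred_eq_of_pos (Nat.lt_of_lt_of_le a.succ_pos this)⟩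
    refine ⟨s.image Nat.pred, ⟨?_, fun x hx => ?_⟩, hmap⟩
    · rw [← hc, ← Finset.card_map (addRightEmbedding 1), hmap]
    · obtain ⟨y, hy, rfl⟩ := Finset.mem_image.1 hx
      exact Nat.le_pred_of_lt (hs y hy)
  · rintro ⟨r, ⟨hc, hr⟩, rfl⟩
    refine ⟨by simpa using hc, fun x hx => ?_⟩
    obtain ⟨y, hy, rfl⟩ := Finset.mem_map.1 hx
    exact Nat.succ_le_succ (hr y hy)

lemma weightGF_distinctGE_one (j : ℕ) :
    weightGF (fun s : Finset ℕ => ∑ x ∈ s, x) (distinctGE j 1) =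
      X ^ (∑ i ∈ Finset.range (j + 1), i) * invQFactorial j := by
  have hshift : ∀ j, weightGF (fun s : Finset ℕ => ∑ x ∈ s, x) (distinctGE j 2) =
      X ^ j * weightGF (fun s : Finset ℕ => ∑ x ∈ s, x) (distinctGE j 1) := by
    intro j
    rw [distinctGE_shift j 1, weightGF_image j (Finset.map_injective _).injOn]
    rintro s ⟨hc, -⟩
    simp [Finset.sum_add_distrib, hc]
  induction j with
  | zero =>
    have : distinctGE 0 1 = {∅} := by
      ext s
      simp only [distinctGE, Set.mem_ofPred_eq, Finset.card_eq_zero, Set.mem_singleton_iff]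
      exact ⟨fun h => h.1, by rintro rfl; simp⟩
    rw [this, weightGF_singleton (by simp)]
    simp [invQFactorial]
  | succ j ih =>
    have hmem : ∀ s ∈ distinctGE j 2, 1 ∉ s := fun s hs h => by have := hs.2 1 h; omega
    have h1 := congrArg (weightGF (fun s : Finset ℕ => ∑ x ∈ s, x)) (distinctGE_succ j 1)
    rw [weightGF_union ((finiteFibres_distinctGE (j + 1) 1).mono
        (by rw [distinctGE_succ j 1]; exact Set.subset_union_left))
      (finiteFibres_distinctGE (j + 1) 2) ?_,
      weightGF_image (f' := fun s : Finset ℕ => ∑ x ∈ s, x) 1 ?_ ?_, hshift, hshift, ih] at h1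
    · apply mul_left_cancel₀ (one_sub_X_pow_ne_zero j)
      rw [mul_left_comm, one_sub_X_pow_mul_invQFactorial, Finset.sum_range_succ _ (j + 1)]
      linear_combination h1
    · intro s hs t ht h
      simp only at h
      rw [← Finset.erase_insert (hmem s hs), h, Finset.erase_insert (hmem t ht)]
    · intro s hs
      simp only [Finset.sum_insert (hmem s hs), add_comm]
    · rw [Set.disjoint_left]
      rintro s ⟨r, -, rfl⟩ ⟨-, hs⟩
      have := hs 1 (by simp)
      omega

/-- The generating function of the pairs of distinct partitions with birank `m` whose first
component has `d` parts. -/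
noncomputable def birankTerm (m : ℤ) (d : ℕ) : ℤ⟦X⟧ :=
  if 0 ≤ d + m then
    X ^ (d * (d + m).toNat + d) * (invQFactorial d * invQFactorial (d + m).toNat)
  else 0

/-- The generating function of the partitions with crank `m` and `w` parts equal to `1`, up to
the correction in degree `1`. -/
noncomputable def crankTerm (m : ℤ) (w : ℕ) : ℤ⟦X⟧ :=
  if 0 ≤ w + m then
    X ^ (w + (w + m).toNat * (w + 1)) * (1 - X) *
      (invQFactorial w * invQFactorial (w + m).toNat)
  else 0

/-- The telescoping remainder relating `birankTerm` and `crankTerm`. -/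
noncomputable def telescopeTerm (m : ℤ) (d : ℕ) : ℤ⟦X⟧ :=
  if 0 ≤ d + m then
    X ^ (d * (d + m).toNat) * (1 - X ^ d) * (1 - X ^ (d + m).toNat) *
      (invQFactorial d * invQFactorial (d + m).toNat)
  else 0

lemma birankTerm_sub_birankTerm (m : ℤ) (d : ℕ) :
    birankTerm m d - birankTerm (m - 1) d - crankTerm m d =
      telescopeTerm m (d + 1) - telescopeTerm m d := by
  unfold birankTerm crankTerm telescopeTerm
  have hd := one_sub_X_pow_mul_invQFactorial d
  rcases lt_or_ge ((d : ℤ) + m) 0 with h | h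
  · have h1 : ¬ 0 ≤ (d : ℤ) + m := by omega
    have h2 : ¬ 0 ≤ (d : ℤ) + (m - 1) := by omega
    simp only [if_neg h1, if_neg h2]
    split_ifs with h3
    · rw [show (((d + 1 : ℕ) : ℤ) + m).toNat = 0 by omega]
      simp
    · simp
  · obtain ⟨j, hj⟩ := Int.eq_ofNat_of_zero_le h
    have hj' := one_sub_X_pow_mul_invQFactorial j
    have h1 : 0 ≤ ((d + 1 : ℕ) : ℤ) + m := by omega
    simp only [if_pos h, if_pos h1]
    rw [show (((d + 1 : ℕ) : ℤ) + m).toNat = j + 1 by omega,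
      show ((d : ℤ) + m).toNat = j by omega]
    have e1 : (X : ℤ⟦X⟧) ^ ((d + 1) * (j + 1)) * (1 - X ^ (d + 1)) * (1 - X ^ (j + 1)) *
        (invQFactorial (d + 1) * invQFactorial (j + 1)) =
        X ^ ((d + 1) * (j + 1)) * (invQFactorial d * invQFactorial j) := by
      rw [← hd, ← hj']; ring
    rw [e1]
    rcases j with _ | j
    · have h2 : ¬ 0 ≤ (d : ℤ) + (m - 1) := by omega
      simp only [if_neg h2, mul_zero, zero_mul, pow_zero, sub_self, zero_add, add_zero, one_mul]
      ring
    · have h2 : 0 ≤ (d : ℤ) + (m - 1) := by omega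
      simp only [if_pos h2]
      rw [show ((d : ℤ) + (m - 1)).toNat = j by omega,
        ← one_sub_X_pow_mul_invQFactorial j]
      ring

lemma coeff_telescopeTerm (m : ℤ) (t : ℕ) : coeff t (telescopeTerm m (t + 1)) = 0 := by
  unfold telescopeTerm
  split_ifs with h
  · rcases Nat.eq_zero_or_pos (((t + 1 : ℕ) : ℤ) + m).toNat with h' | h'
    · rw [h']
      simp
    · rw [mul_assoc, mul_assoc, coeff_X_pow_mul', if_neg]
      have := Nat.mul_le_mul_left (t + 1) h'
      omega
  · simp

lemma sum_coeff_birankTerm_sub (m : ℤ) (t : ℕ) :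
    ∑ d ∈ Finset.range (t + 1), coeff t (birankTerm m d) -
      ∑ d ∈ Finset.range (t + 1), coeff t (birankTerm (m - 1) d) =
      ∑ d ∈ Finset.range (t + 1), coeff t (crankTerm m d) := by
  have h0 : telescopeTerm m 0 = 0 := by simp [telescopeTerm]
  have h := Finset.sum_range_sub (fun d => coeff t (telescopeTerm m d)) (t + 1)
  simp only [← map_sub, ← birankTerm_sub_birankTerm] at h
  rw [h0, sub_zero, coeff_telescopeTerm] at h
  simp only [map_sub, Finset.sum_sub_distrib] at h
  linear_combination h

lemma ncard_eq_sum_range {α : Type*} {A : Set α} (c : α → ℕ) {T : ℕ}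
    (hA : ∀ d, (A ∩ c ⁻¹' {d}).Finite) (hT : ∀ d, T ≤ d → (A ∩ c ⁻¹' {d}).ncard = 0) :
    A.ncard = ∑ d ∈ Finset.range T, (A ∩ c ⁻¹' {d}).ncard := by
  classical
  have : A = ↑((Finset.range T).biUnion fun d => (hA d).toFinset) := by
    ext x
    simp only [Finset.coe_biUnion, Finset.mem_coe, Finset.mem_range, Set.Finite.coe_toFinset,
      Set.mem_iUnion, exists_prop]
    constructor
    · intro hx
      refine ⟨c x, ?_, hx, rfl⟩
      by_contra h
      have := (Set.ncard_eq_zero (hA _)).1 (hT (c x) (by omega))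
      exact Set.notMem_empty x (this ▸ ⟨hx, rfl⟩)
    · rintro ⟨d, -, hx, -⟩
      exact hx
  conv_lhs => rw [this]
  rw [Set.ncard_coe_finset, Finset.card_biUnion]
  · exact Finset.sum_congr rfl fun d _ => (Set.ncard_eq_toFinset_card _ (hA d)).symm
  · intro i _ j _ hij
    refine Finset.disjoint_left.2 ?_
    intro x h1 h2
    simp only [Set.Finite.mem_toFinset, Set.mem_inter_iff, Set.mem_preimage,
      Set.mem_singleton_iff] at h1 h2
    exact hij (h1.2.symm.trans h2.2)

/-- The set of distinct integer bipartitions of doubled weight `D` and birank `m`. -/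
def bipartitions (D m : ℤ) : Set (Finset ℕ × Finset ℕ) :=
  {p | 0 ∉ p.1 ∧ 0 ∉ p.2 ∧ W2 p = D ∧ birank p = m}

lemma mul_add_le_sum_range_add_sum_range (d j : ℕ) :
    d * j + d ≤ (∑ i ∈ Finset.range (d + 1), i) + ∑ i ∈ Finset.range (j + 1), i := by
  have hd := Finset.sum_range_id_mul_two (d + 1)
  have hj := Finset.sum_range_id_mul_two (j + 1)
  simp only [Nat.add_sub_cancel] at hd hj
  rcases le_or_gt d j with h | h
  · obtain ⟨e, rfl⟩ := Nat.exists_eq_add_of_le h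
    nlinarith
  · obtain ⟨e, rfl⟩ := Nat.exists_eq_add_of_lt h
    nlinarith

lemma bipartitions_fibre {D m : ℤ} {t d j : ℕ} (h : D - m = 4 * t) (hj : (j : ℤ) = d + m) :
    bipartitions D m ∩ (fun p => p.1.card) ⁻¹' {d} =
      (distinctGE d 1 ×ˢ distinctGE j 1) ∩
        (fun p : Finset ℕ × Finset ℕ => (∑ x ∈ p.1, x) + ∑ x ∈ p.2, x) ⁻¹'
          {t + (∑ i ∈ Finset.range (d + 1), i) + (∑ i ∈ Finset.range (j + 1), i)
            - (d * j + d)} := by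
  have hd := Finset.sum_range_id_mul_two (d + 1)
  have hj2 := Finset.sum_range_id_mul_two (j + 1)
  set a := ∑ i ∈ Finset.range (d + 1), i
  set b := ∑ i ∈ Finset.range (j + 1), i
  have hle : d * j + d ≤ a + b := mul_add_le_sum_range_add_sum_range d j
  simp only [Nat.add_sub_cancel] at hd hj2
  ext ⟨p, q⟩
  simp only [bipartitions, birank, W2, distinctGE, Set.mem_inter_iff, Set.mem_ofPred_eq,
    Set.mem_preimage, Set.mem_singleton_iff, Set.mem_prod, Nat.one_le_iff_ne_zero]
  have h0 : ∀ s : Finset ℕ, 0 ∉ s ↔ ∀ x ∈ s, x ≠ 0 :=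
    fun s => ⟨fun h x hx hx0 => h (hx0 ▸ hx), fun h hx => h 0 hx rfl⟩
  rw [h0, h0]
  zify at hd hj2 hle
  have hN : ∀ S : ℕ, S = t + a + b - (d * j + d) ↔ (2 * S : ℤ) = 2 * t + m * (m + 1) := by
    intro S
    have e : (2 * (a + b) : ℤ) = 2 * (d * j + d) + m * (m + 1) := by
      have : m = j - d := by linarith
      subst this
      linarith
    zify [show d * j + d ≤ t + a + b by zify; linarith]
    constructor <;> intro h <;> linarith
  rw [hN]
  push_cast
  constructor
  · rintro ⟨⟨hp, hq, hW, hm⟩, hc⟩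
    have hcq : q.card = j := by omega
    refine ⟨⟨⟨hc, hp⟩, hcq, hq⟩, ?_⟩
    rw [hc, hcq] at hW
    have : m = j - d := by linarith
    subst this
    linarith
  · rintro ⟨⟨⟨hc, hp⟩, hcq, hq⟩, hS⟩
    refine ⟨⟨hp, hq, ?_, by omega⟩, hc⟩
    rw [hc, hcq]
    have : m = j - d := by linarith
    subst this
    linarith

lemma bipartitions_fibre_eq_empty {D m : ℤ} {d : ℕ} (hd : (d : ℤ) + m < 0) :
    bipartitions D m ∩ (fun p => p.1.card) ⁻¹' {d} = ∅ := by
  ext p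
  simp only [bipartitions, birank, Set.mem_inter_iff, Set.mem_ofPred_eq, Set.mem_preimage,
    Set.mem_singleton_iff, Set.mem_empty_iff_false, iff_false]
  rintro ⟨⟨-, -, -, h⟩, hc⟩
  omega

lemma finite_bipartitions_fibre {D m : ℤ} {t : ℕ} (h : D - m = 4 * t) (d : ℕ) :
    (bipartitions D m ∩ (fun p => p.1.card) ⁻¹' {d}).Finite := by
  rcases lt_or_ge (d + m) 0 with hd | hd
  · rw [bipartitions_fibre_eq_empty hd]; exact Set.finite_empty
  · obtain ⟨j, hj⟩ := Int.eq_ofNat_of_zero_le hd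
    rw [bipartitions_fibre h hj.symm]
    generalize t + (∑ i ∈ Finset.range (d + 1), i) + (∑ i ∈ Finset.range (j + 1), i)
      - (d * j + d) = N
    refine (Finset.finite_toSet ((Finset.range (N + 1)).powerset ×ˢ
      (Finset.range (N + 1)).powerset)).subset ?_
    rintro ⟨p, q⟩ ⟨-, hs⟩
    simp only [Set.mem_preimage, Set.mem_singleton_iff] at hs
    have hle : ∀ (s : Finset ℕ), ∀ x ∈ s, x ≤ ∑ y ∈ s, y := fun s x hx =>
      Finset.single_le_sum (f := fun x => x) (fun _ _ => Nat.zero_le _) hx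
    simp only [Finset.mem_coe, Finset.mem_product, Finset.mem_powerset]
    constructor <;> intro x hx <;> rw [Finset.mem_range] <;> have := hle _ x hx <;> omega

lemma ncard_bipartitions_fibre {D m : ℤ} {t : ℕ} (h : D - m = 4 * t) (d : ℕ) :
    ((bipartitions D m ∩ (fun p => p.1.card) ⁻¹' {d}).ncard : ℤ) = coeff t (birankTerm m d) := by
  unfold birankTerm
  split_ifs with hd
  · obtain ⟨j, hj⟩ := Int.eq_ofNat_of_zero_le hd
    rw [bipartitions_fibre h hj.symm, ← coeff_weightGF, weightGF_prod
      (finiteFibres_distinctGE d 1) (finiteFibres_distinctGE j 1), weightGF_distinctGE_one,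
      weightGF_distinctGE_one, mul_mul_mul_comm, ← pow_add, coeff_X_pow_mul', coeff_X_pow_mul',
      show ((d : ℤ) + m).toNat = j by omega]
    have hle := mul_add_le_sum_range_add_sum_range d j
    generalize ∑ i ∈ Finset.range (d + 1), i = a at *
    generalize ∑ i ∈ Finset.range (j + 1), i = b at *
    by_cases hlt : d * j + d ≤ t
    · rw [if_pos hlt, if_pos (by omega)]
      congr 2
      omega
    · rw [if_neg hlt, if_neg (by omega)]
  · rw [bipartitions_fibre_eq_empty (by omega)]
    simp

lemma coeff_birankTerm_of_lt (m : ℤ) {t d : ℕ} (h : t < d) : coeff t (birankTerm m d) = 0 := by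
  unfold birankTerm
  split_ifs
  · rw [coeff_X_pow_mul', if_neg (by omega)]
  · simp

lemma coeff_crankTerm_of_lt (m : ℤ) {t w : ℕ} (h : t < w) : coeff t (crankTerm m w) = 0 := by
  unfold crankTerm
  split_ifs
  · rw [mul_assoc, coeff_X_pow_mul', if_neg (by omega)]
  · simp

lemma ncard_bipartitions {D m : ℤ} {t : ℕ} (h : D - m = 4 * t) :
    ((bipartitions D m).ncard : ℤ) =
      ∑ d ∈ Finset.range (t + 1), coeff t (birankTerm m d) := by
  rw [ncard_eq_sum_range (fun p => p.1.card) (finite_bipartitions_fibre h) (T := t + 1)]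
  · push_cast
    exact Finset.sum_congr rfl fun d _ => ncard_bipartitions_fibre h d
  · intro d hd
    have := ncard_bipartitions_fibre h d
    rw [coeff_birankTerm_of_lt m (by omega)] at this
    exact_mod_cast this

/-- The Dyson crank of a multiset of parts. -/
def multisetCrank (s : Multiset ℕ) : ℤ :=
  if s.count 1 = 0 then (s.sup : ℤ)
  else ((s.filter (fun x => s.count 1 < x)).card : ℤ) - (s.count 1 : ℤ)

/-- The multisets of parts of the partitions of `t` with crank `m`. -/
def crankSet (m : ℤ) (t : ℕ) : Set (Multiset ℕ) :=
  {s | 0 ∉ s ∧ s.sum = t ∧ multisetCrank s = m}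

lemma card_partition_crank (m : ℤ) (t : ℕ) :
    Nat.card {lam : Nat.Partition t // crank lam = m} = (crankSet m t).ncard := by
  have : crankSet m t = Nat.Partition.parts '' {lam : Nat.Partition t | crank lam = m} := by
    ext s
    simp only [crankSet, Set.mem_image, Set.mem_ofPred_eq]
    constructor
    · rintro ⟨h0, hs, hc⟩
      exact ⟨⟨s, fun {i} hi => Nat.pos_of_ne_zero fun h => h0 (h ▸ hi), hs⟩, hc, rfl⟩
    · rintro ⟨lam, hc, rfl⟩
      exact ⟨fun h => (lam.parts_pos h).ne rfl, lam.parts_sum, hc⟩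
  rw [this, Set.ncard_image_of_injective _ fun _ _ => Nat.Partition.ext]
  rfl

lemma crankSet_fibre_succ {m : ℤ} {t w j : ℕ} (hj : (j : ℤ) = (w + 1 : ℕ) + m) :
    crankSet m t ∩ Multiset.count 1 ⁻¹' {w + 1} =
      {s : Multiset ℕ | 0 ∉ s ∧ s.count 1 = w + 1 ∧
        (s.filter (fun x => w + 1 < x)).card = j} ∩ Multiset.sum ⁻¹' {t} := by
  ext s
  simp only [crankSet, multisetCrank, Set.mem_inter_iff, Set.mem_ofPred_eq, Set.mem_preimage,
    Set.mem_singleton_iff]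
  constructor
  · rintro ⟨⟨h0, hs, hc⟩, h1⟩
    rw [h1, if_neg (by omega)] at hc
    exact ⟨⟨h0, h1, by omega⟩, hs⟩
  · rintro ⟨⟨h0, h1, hc⟩, hs⟩
    refine ⟨⟨h0, hs, ?_⟩, h1⟩
    rw [h1, if_neg (by omega)]
    omega

lemma ncard_crankSet_fibre {t : ℕ} (ht : t ≠ 1) (m : ℤ) (w : ℕ) :
    ((crankSet m t ∩ Multiset.count 1 ⁻¹' {w}).ncard : ℤ) = coeff t (crankTerm m w) := by
  unfold crankTerm
  have hempty : ∀ A : Set (Multiset ℕ), (∀ s, s ∉ A) → A.ncard = 0 := fun A hA => by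
    rw [Set.eq_empty_of_forall_notMem hA, Set.ncard_empty]
  rcases w with _ | w
  · have hfib : crankSet m t ∩ Multiset.count 1 ⁻¹' {0} =
        {s : Multiset ℕ | 0 ∉ s ∧ s.count 1 = 0 ∧ (s.sup : ℤ) = m} ∩ Multiset.sum ⁻¹' {t} := by
      ext s
      simp only [crankSet, multisetCrank, Set.mem_inter_iff, Set.mem_ofPred_eq, Set.mem_preimage,
        Set.mem_singleton_iff]
      constructor
      · rintro ⟨⟨h0, hs, hc⟩, h1⟩
        exact ⟨⟨h0, h1, by rwa [if_pos h1] at hc⟩, hs⟩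
      · rintro ⟨⟨h0, h1, hc⟩, hs⟩
        exact ⟨⟨h0, hs, by rwa [if_pos h1]⟩, h1⟩
    rw [hfib]
    split_ifs with hm
    · obtain ⟨k, rfl⟩ := Int.eq_ofNat_of_zero_le (show 0 ≤ m by simpa using hm)
      simp only [Nat.cast_inj, Nat.cast_zero, zero_add, Int.toNat_natCast, mul_one,
        show invQFactorial 0 = 1 from rfl, one_mul]
      rcases k with _ | _ | k
      · have : {s : Multiset ℕ | 0 ∉ s ∧ s.count 1 = 0 ∧ s.sup = 0} = {0} := by
          ext s
          simp only [Set.mem_ofPred_eq, Set.mem_singleton_iff]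
          constructor
          · rintro ⟨h0, -, hs⟩
            refine Multiset.eq_zero_of_forall_notMem fun x hx => h0 ?_
            have := Multiset.le_sup hx
            rw [hs, Nat.le_zero] at this
            rwa [this] at hx
          · rintro rfl
            simp
        rw [this, ← coeff_weightGF, weightGF_singleton (by simp)]
        simp [invQFactorial, coeff_X, ht]
      · rw [hempty]
        · simp only [invQFactorial, zero_add, pow_one, one_mul]
          rw [mul_assoc, PowerSeries.mul_invOfUnit _ _ (by simp), mul_one, coeff_X, if_neg ht]
          rfl
        · rintro s ⟨⟨h0, h1, hs⟩, -⟩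
          have hle : ∀ x ∈ s, x ≤ 1 := fun x hx => by
            have := Multiset.le_sup hx
            omega
          have : s = 0 := Multiset.eq_zero_of_forall_notMem fun x hx => by
            have := hle x hx
            rw [Multiset.count_eq_zero] at h1
            interval_cases x
            · exact h0 hx
            · exact h1 hx
          rw [this] at hs
          simp at hs
      · rw [← coeff_weightGF, weightGF_sup]
    · rw [hempty]
      · simp
      · rintro s ⟨⟨-, -, h⟩, -⟩
        omega
  · split_ifs with hw
    · obtain ⟨j, hj⟩ := Int.eq_ofNat_of_zero_le hw
      rw [crankSet_fibre_succ hj.symm, ← coeff_weightGF, weightGF_count_one,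
        show (((w + 1 : ℕ) : ℤ) + m).toNat = j by omega]
    · rw [hempty]
      · simp
      · rintro s ⟨⟨-, -, h⟩, h1⟩
        simp only [Set.mem_preimage, Set.mem_singleton_iff] at h1
        rw [multisetCrank, if_neg (by omega), h1] at h
        omega

lemma sum_coeff_crankTerm_one (m : ℤ) :
    ∑ w ∈ Finset.range 2, coeff 1 (crankTerm m w) =
      if m = 1 ∨ m = -1 then 1 else if m = 0 then -1 else 0 := by
  rw [Finset.sum_range_succ, Finset.sum_range_one]
  unfold crankTerm
  rcases lt_trichotomy m (-1) with h | rfl | h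
  · rw [if_neg (by omega), if_neg (by omega), if_neg (by omega), if_neg (by omega)]
    simp
  · rw [if_neg (by omega), if_pos (by omega), show (((1 : ℕ) : ℤ) + -1).toNat = 0 from rfl,
      mul_assoc, coeff_X_pow_mul', if_pos (by omega)]
    simp [constantCoeff_invQFactorial]
  · obtain ⟨k, rfl⟩ := Int.eq_ofNat_of_zero_le (show 0 ≤ m by omega)
    rw [if_pos (by omega), if_pos (by omega), show (((0 : ℕ) : ℤ) + k).toNat = k by omega,
      show (((1 : ℕ) : ℤ) + k).toNat = k + 1 by omega, mul_assoc, mul_assoc, coeff_X_pow_mul',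
      coeff_X_pow_mul', if_neg (show ¬ 1 + (k + 1) * (1 + 1) ≤ 1 by omega)]
    rcases k with _ | _ | k
    · simp [invQFactorial, coeff_one]
    · simp [constantCoeff_invQFactorial]
    · rw [if_neg (by omega), if_neg (by omega), if_neg (by omega), add_zero]

lemma Ncrank_eq_sum (m : ℤ) (t : ℕ) :
    Ncrank m t = ∑ w ∈ Finset.range (t + 1), coeff t (crankTerm m w) := by
  unfold Ncrank
  split_ifs with ht h1 h2
  · subst ht
    rw [sum_coeff_crankTerm_one, if_pos h1]
  · subst ht
    rw [sum_coeff_crankTerm_one, if_neg h1, if_pos h2]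
  · subst ht
    rw [sum_coeff_crankTerm_one, if_neg h1, if_neg h2]
  · have hfin : (crankSet m t).Finite :=
      (finiteFibres_multiset t).subset fun s hs => ⟨hs.1, hs.2.1⟩
    rw [card_partition_crank, ncard_eq_sum_range (Multiset.count 1)
      (fun d => hfin.subset Set.inter_subset_left) (T := t + 1)]
    · push_cast
      exact Finset.sum_congr rfl fun w _ => ncard_crankSet_fibre ht m w
    · intro w hw
      have := ncard_crankSet_fibre ht m w
      rw [coeff_crankTerm_of_lt m (by omega)] at this
      exact_mod_cast this

lemma sum_coeff_birankTerm_of_lt {m : ℤ} {t : ℕ} (h : m < -t) :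
    ∑ d ∈ Finset.range (t + 1), coeff t (birankTerm m d) = 0 := by
  refine Finset.sum_eq_zero fun d hd => ?_
  rw [Finset.mem_range] at hd
  rw [birankTerm, if_neg (by omega), map_zero]

lemma finsum_Ncrank (m : ℤ) (t : ℕ) :
    ∑ᶠ l : ℕ, Ncrank (m - l) t = ∑ d ∈ Finset.range (t + 1), coeff t (birankTerm m d) := by
  set c : ℤ → ℤ := fun m => ∑ d ∈ Finset.range (t + 1), coeff t (birankTerm m d) with hc
  have hN : ∀ l : ℕ, Ncrank (m - l) t = c (m - l) - c (m - (l + 1 : ℕ)) := by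
    intro l
    rw [Ncrank_eq_sum, ← sum_coeff_birankTerm_sub, Nat.cast_add, Nat.cast_one, ← sub_sub]
  have h0 : ∀ l : ℕ, (m + t + 1).toNat ≤ l → c (m - l) = 0 := fun l hl =>
    sum_coeff_birankTerm_of_lt (by omega)
  rw [finsum_eq_sum_of_support_subset (s := Finset.range (m + t + 1).toNat)]
  · rw [Finset.sum_congr rfl fun l _ => hN l,
      Finset.sum_range_sub' (fun l : ℕ => c (m - l)), h0 _ le_rfl]
    simp [hc]
  · intro l hl
    rw [Finset.coe_range, Set.mem_Iio]
    by_contra hlt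
    exact hl (by simp only; rw [hN, h0 l (by omega), h0 (l + 1) (by omega), sub_zero])

end CrankCount

/-- **Counting highest weight vectors by degree and charge via the Dyson crank:** if
`D − m = 4t`, the number of distinct integer bipartitions with doubled weight `D` and
birank `m` (i.e. of highest weight vectors of the untwisted Heisenberg action on the CKP
Fock space with degree `D/2` and charge `m`) equals `∑_{l∈ℕ} N'(m − l, t)`. -/
theorem ckp_hwv_count_by_dyson_crank (D : ℕ) (m : ℤ) (t : ℕ)
    (h : (D : ℤ) - m = 4 * (t : ℤ)) :
    (Nat.card {p : Finset ℕ × Finset ℕ //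
        0 ∉ p.1 ∧ 0 ∉ p.2 ∧ W2 p = (D : ℤ) ∧ birank p = m} : ℤ)
      = ∑ᶠ l : ℕ, Ncrank (m - (l : ℤ)) t := by
  rw [CrankCount.finsum_Ncrank, ← CrankCount.ncard_bipartitions h]
  rfl
end
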